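/- Let 2 ≤ k ≤ 20 and let a_1 (mod m_1), …, a_k (mod m_k) be k pairwise disjoint congruence classes (with each m_i a positive integer and each a_i an integer). Then there exist indices i < j such that gcd(m_i, m_j) ≥ k. -/

import Mathlib

/-- The congruence class of `a` modulo `m`, as a set of integers. -/
def congClass (a : ℤ) (m : ℕ) : Set ℤ :=
  {x : ℤ | Int.ModEq (m : ℤ) x a}

namespace DC

/-! ### Part 1: proper colouring of the big divisors -/

/-- prime / exponent list of `lcm(1..N)`, in an order suitable for greedy colouring -/
def pl (N : ℕ) : List (ℕ × ℕ) :=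
  [(7, cond (Nat.ble 7 N) 1 0), (17, cond (Nat.ble 17 N) 1 0),
   (3, cond (Nat.ble 9 N) 2 (cond (Nat.ble 3 N) 1 0)), (13, cond (Nat.ble 13 N) 1 0),
   (19, cond (Nat.ble 19 N) 1 0),
   (2, cond (Nat.ble 16 N) 4 (cond (Nat.ble 8 N) 3 (cond (Nat.ble 4 N) 2 (cond (Nat.ble 2 N) 1 0)))),
   (11, cond (Nat.ble 11 N) 1 0), (5, cond (Nat.ble 5 N) 1 0)]
def prodL : List (ℕ × ℕ) → ℕ
  | [] => 1
  | q :: t => q.1 ^ q.2 * prodL t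
def dl : List (ℕ × ℕ) → List ℕ
  | [] => [1]
  | q :: t => (List.range (q.2 + 1)).flatMap fun j => (dl t).map fun x => q.1 ^ j * x
def incomp (N v w : ℕ) : Bool := (Nat.beq (Nat.gcd v w) 1) || Nat.blt N (Nat.gcd v w)
def ins (N v : ℕ) : List (List ℕ) → List (List ℕ)
  | [] => [[v]]
  | c :: cs => cond (c.all fun w => incomp N v w) ((v :: c) :: cs) (c :: ins N v cs)
def greedy (N : ℕ) : List ℕ → List (List ℕ) → List (List ℕ)
  | [], cs => cs
  | v :: vs, cs => greedy N vs (cond (Nat.ble v N) cs (ins N v cs))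
def chk (N : ℕ) : Bool := Nat.ble (greedy N (dl (pl N)) []).length N

theorem chk_all : ∀ N, 2 ≤ N → N ≤ 19 → chk N = true := by
  intro N h1 h2
  interval_cases N <;> decide +kernel

/-- `lcm(1..N)` for `N ≤ 19` -/
def LN (N : ℕ) : ℕ := prodL (pl N)

theorem mem_dl (l : List (ℕ × ℕ)) (hl : ∀ q ∈ l, q.1.Prime) (x : ℕ) (hx : x ∣ prodL l) :
    x ∈ dl l := by
  induction l generalizing x with
  | nil => simpa [dl, prodL] using hx
  | cons q t ih =>
    simp only [prodL] at hx
    obtain ⟨y, z, hy, hz, rfl⟩ := (Nat.dvd_mul).1 hx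
    have hq : q.1.Prime := hl q (by simp)
    obtain ⟨j, hj, rfl⟩ := (Nat.dvd_prime_pow hq).1 hy
    simp only [dl, List.mem_flatMap, List.mem_range, List.mem_map]
    exact ⟨j, by omega, z, ih (fun q hq => hl q (by simp [hq])) z hz, rfl⟩

theorem pl_prime (N : ℕ) : ∀ q ∈ pl N, q.1.Prime := by
  intro q hq
  simp only [pl, List.mem_cons, List.not_mem_nil, or_false] at hq
  rcases hq with h | h | h | h | h | h | h | h <;> subst h <;> norm_num

theorem prime_dvd_prodL (l : List (ℕ × ℕ)) (hl : ∀ q ∈ l, q.1.Prime) (p : ℕ) (hp : p.Prime)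
    (h : p ∣ prodL l) : ∃ q ∈ l, q.1 = p ∧ q.2 ≠ 0 := by
  induction l with
  | nil => simp [prodL] at h; exact absurd h hp.one_lt.ne'
  | cons q t ih =>
    simp only [prodL] at h
    rcases (Nat.Prime.dvd_mul hp).1 h with h | h
    · refine ⟨q, by simp, ?_, ?_⟩
      · exact ((Nat.prime_dvd_prime_iff_eq hp (hl q (by simp))).1 (hp.dvd_of_dvd_pow h)).symm
      · intro h0
        rw [h0] at h; simp at h; exact absurd h hp.one_lt.ne'
    · obtain ⟨q', h1, h2⟩ := ih (fun q hq => hl q (by simp [hq])) h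
      exact ⟨q', by simp [h1], h2⟩

theorem LN_prime_le (N p : ℕ) (hp : p.Prime) (h : p ∣ LN N) : p ≤ N := by
  obtain ⟨q, h1, h2, h3⟩ := prime_dvd_prodL _ (pl_prime N) p hp h
  simp only [pl, List.mem_cons, List.not_mem_nil, or_false] at h1
  by_contra hlt
  push Not at hlt
  rcases h1 with h | h | h | h | h | h | h | h <;> subst h <;> simp only [] at h2 h3 <;> subst h2 <;>
    revert h3 <;> interval_cases N <;> decide

theorem dvd_LN : ∀ N ≤ 19, ∀ d ≤ N, 1 ≤ d → d ∣ LN N := by decide +kernel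
theorem LN_dvd : ∀ N ≤ 19, LN N ∣ 232792560 := by decide +kernel

theorem ins_inv (N v : ℕ) (cs : List (List ℕ))
    (h : ∀ c ∈ cs, c.Pairwise fun x y => incomp N x y = true) :
    ∀ c ∈ ins N v cs, c.Pairwise fun x y => incomp N x y = true := by
  induction cs with
  | nil => simp [ins]
  | cons c cs ih =>
    simp only [ins]
    cases hc : (c.all fun w => incomp N v w)
    · simp only [cond_false, List.mem_cons, forall_eq_or_imp]
      exact ⟨h c (by simp), ih fun c hc => h c (by simp [hc])⟩
    · simp only [cond_true, List.mem_cons, forall_eq_or_imp, List.pairwise_cons]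
      exact ⟨⟨by simpa using hc, h c (by simp)⟩, fun c hc => h c (by simp [hc])⟩

theorem ins_cov (N v : ℕ) (cs : List (List ℕ)) (x : ℕ) (h : x = v ∨ ∃ c ∈ cs, x ∈ c) :
    ∃ c ∈ ins N v cs, x ∈ c := by
  induction cs with
  | nil => simpa [ins] using h
  | cons c cs ih =>
    simp only [ins]
    cases hc : (c.all fun w => incomp N v w)
    · simp only [cond_false, List.mem_cons, exists_eq_or_imp] at h ⊢
      rcases h with h | h | h
      · exact Or.inr (ih (Or.inl h))
      · exact Or.inl h
      · exact Or.inr (ih (Or.inr h))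
    · simp only [cond_true, List.mem_cons, exists_eq_or_imp] at h ⊢
      tauto

theorem greedy_inv (N : ℕ) (vs : List ℕ) (cs : List (List ℕ))
    (h : ∀ c ∈ cs, c.Pairwise fun x y => incomp N x y = true) :
    ∀ c ∈ greedy N vs cs, c.Pairwise fun x y => incomp N x y = true := by
  induction vs generalizing cs with
  | nil => simpa [greedy] using h
  | cons v vs ih =>
    simp only [greedy]
    apply ih
    cases Nat.ble v N
    · exact ins_inv N v cs h
    · exact h

theorem greedy_cov (N : ℕ) (vs : List ℕ) (cs : List (List ℕ)) (x : ℕ) (hx : N < x)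
    (h : x ∈ vs ∨ ∃ c ∈ cs, x ∈ c) : ∃ c ∈ greedy N vs cs, x ∈ c := by
  induction vs generalizing cs with
  | nil => simpa [greedy] using h
  | cons v vs ih =>
    simp only [greedy]
    apply ih
    cases hv : Nat.ble v N
    · simp only [cond_false]
      rcases h with h | h
      · rcases List.mem_cons.1 h with h | h
        · exact Or.inr (ins_cov N v cs x (Or.inl h))
        · exact Or.inl h
      · exact Or.inr (ins_cov N v cs x (Or.inr h))
    · simp only [cond_true]
      rcases h with h | h
      · rcases List.mem_cons.1 h with h | h
        · have := Nat.le_of_ble_eq_true hv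
          omega
        · exact Or.inl h
      · exact Or.inr h

theorem colour (N : ℕ) (h2 : 2 ≤ N) (h19 : N ≤ 19) {ι : Type} (J : Finset ι) (m : ι → ℕ)
    (h1 : ∀ x ∈ J, N < m x ∧ m x ∣ LN N)
    (hc : ∀ x ∈ J, ∀ y ∈ J, x ≠ y → 1 < Nat.gcd (m x) (m y) ∧ Nat.gcd (m x) (m y) ≤ N) :
    J.card ≤ N := by
  have hchk := Nat.le_of_ble_eq_true (chk_all N h2 h19)
  set cs := greedy N (dl (pl N)) [] with hcs
  have hcov : ∀ x ∈ J, ∃ k : ℕ, ∃ hk : k < cs.length, m x ∈ cs[k] := by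
    intro x hx
    obtain ⟨c, hc, hxc⟩ := greedy_cov N (dl (pl N)) [] (m x) (h1 x hx).1
      (Or.inl (mem_dl _ (pl_prime N) _ (h1 x hx).2))
    obtain ⟨k, hk, rfl⟩ := List.mem_iff_getElem.1 hc
    exact ⟨k, hk, hxc⟩
  choose! f hf hfm using hcov
  have hinj : Set.InjOn f J := by
    intro x hx y hy hxy
    by_contra hne
    have hgx := hc x hx y hy hne
    have hp := greedy_inv N (dl (pl N)) [] (by simp) (cs[f x]'(hf x hx)) (List.getElem_mem _)
    have hmy : m y ∈ cs[f x]'(hf x hx) := by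
      have := hfm y hy
      simpa only [hxy] using this
    have hne' : m x ≠ m y := by
      intro he
      rw [he, Nat.gcd_self] at hgx
      have := h1 y hy
      omega
    have hsy : Std.Symm (fun x y => incomp N x y = true) :=
      ⟨fun a b hab => by simpa [incomp, Nat.gcd_comm] using hab⟩
    have := List.Pairwise.forall hp (hfm x hx) hmy hne'
    simp only [incomp, Bool.or_eq_true] at this
    rcases this with h | h
    · have := Nat.eq_of_beq_eq_true h
      omega
    · have : N < _ := Nat.le_of_ble_eq_true h
      omega
  calc J.card ≤ (Finset.range cs.length).card :=
        Finset.card_le_card_of_injOn f (fun x hx => by simpa using hf x hx) hinj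
    _ ≤ N := by simpa using hchk
end DC

namespace DC

/-! ### Part 2: systems and basic tools -/

structure Sys {ι : Type} (I : Finset ι) (a : ι → ℤ) (m : ι → ℕ) (N : ℕ) : Prop where
  pos : ∀ i ∈ I, 0 < m i
  le : ∀ i ∈ I, ∀ j ∈ I, i ≠ j → Nat.gcd (m i) (m j) ≤ N
  nd : ∀ i ∈ I, ∀ j ∈ I, i ≠ j → ¬ ((Nat.gcd (m i) (m j) : ℕ) : ℤ) ∣ a i - a j

def PP (ι : Type) (N : ℕ) : Prop :=
  ∀ (I : Finset ι) (a : ι → ℤ) (m : ι → ℕ), Sys I a m N → I.card ≤ max 1 N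

structure Ctx {ι : Type} (I : Finset ι) (a : ι → ℤ) (m : ι → ℕ) (N : ℕ) : Prop
    extends Sys I a m N where
  two : 2 ≤ N
  N19 : N ≤ 19
  ih : ∀ B < N, PP ι B
  dvd : ∀ i ∈ I, m i ∣ LN N
  big : N < I.card
  ex : ∀ p, 2 ≤ p → p ≤ N → ∃ i ∈ I, ¬ p ∣ m i

theorem row {ι : Type} {B n : ℕ} (hP : PP ι B) (J : Finset ι) (a : ι → ℤ) (m : ι → ℕ)
    (hn : 0 < n) (hpos : ∀ i ∈ J, 0 < m i) (hd : ∀ i ∈ J, n ∣ m i)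
    (hc : ∀ i ∈ J, ∀ j ∈ J, a i % (n : ℤ) = a j % n)
    (hg : ∀ i ∈ J, ∀ j ∈ J, i ≠ j → Nat.gcd (m i) (m j) < n * (B + 1))
    (nd : ∀ i ∈ J, ∀ j ∈ J, i ≠ j → ¬ ((Nat.gcd (m i) (m j) : ℕ) : ℤ) ∣ a i - a j) :
    J.card ≤ max 1 B := by
  rcases J.eq_empty_or_nonempty with rfl | ⟨i0, hi0⟩
  · simp
  have hnz : (n : ℤ) ≠ 0 := by exact_mod_cast hn.ne'
  have hr : ∀ i ∈ J, (n : ℤ) * ((a i - a i0) / n) = a i - a i0 := fun i hi =>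
    Int.mul_ediv_cancel' (Int.ModEq.dvd (hc i0 hi0 i hi))
  have hm : ∀ i ∈ J, n * (m i / n) = m i := fun i hi => Nat.mul_div_cancel' (hd i hi)
  have hgg : ∀ i ∈ J, ∀ j ∈ J, Nat.gcd (m i) (m j) = n * Nat.gcd (m i / n) (m j / n) := by
    intro i hi j hj
    rw [← Nat.gcd_mul_left, hm i hi, hm j hj]
  refine hP J (fun i => (a i - a i0) / n) (fun i => m i / n) ⟨?_, ?_, ?_⟩
  · intro i hi
    exact Nat.div_pos (Nat.le_of_dvd (hpos i hi) (hd i hi)) hn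
  · intro i hi j hj hij
    have h1 := hg i hi j hj hij
    rw [hgg i hi j hj] at h1
    have := Nat.lt_of_mul_lt_mul_left h1
    show Nat.gcd (m i / n) (m j / n) ≤ B
    omega
  · intro i hi j hj hij hdv
    apply nd i hi j hj hij
    rw [hgg i hi j hj]
    have h2 : a i - a j = (n : ℤ) * ((a i - a i0) / n - (a j - a i0) / n) := by
      rw [mul_sub, hr i hi, hr j hj]; ring
    rw [h2]
    push_cast
    exact mul_dvd_mul_left _ hdv

theorem cls {ι : Type} (J : Finset ι) (a : ι → ℤ) (n : ℕ) (hn : 0 < n) (W : Finset ℤ)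
    (hW : W ⊆ Finset.Ico 0 (n : ℤ)) (c : ℕ) (h1 : ∀ i ∈ J, a i % (n : ℤ) ∉ W)
    (h2 : ∀ r : ℤ, (J.filter fun i => a i % (n : ℤ) = r).card ≤ c) :
    J.card ≤ c * (n - W.card) := by
  classical
  have h3 := Finset.card_le_mul_card_image (f := fun i => a i % (n : ℤ)) J c (fun b _ => h2 b)
  refine h3.trans (Nat.mul_le_mul_left _ ?_)
  have h4 : J.image (fun i => a i % (n : ℤ)) ⊆ Finset.Ico 0 (n : ℤ) \ W := by
    intro r hr
    obtain ⟨i, hi, rfl⟩ := Finset.mem_image.1 hr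
    have hnz : (0 : ℤ) < n := by exact_mod_cast hn
    simp only [Finset.mem_sdiff, Finset.mem_Ico]
    exact ⟨⟨Int.emod_nonneg _ hnz.ne', Int.emod_lt_of_pos _ hnz⟩, h1 i hi⟩
  have h5 := Finset.card_le_card h4
  rw [Finset.card_sdiff_of_subset hW] at h5
  simpa using h5

theorem strip {ι : Type} (J : Finset ι) (m : ι → ℕ) (S : Finset ℕ)
    (h1 : ∀ i ∈ J, ∃ p ∈ S, p ∣ m i)
    (h2 : ∀ i ∈ J, ∀ j ∈ J, i ≠ j → ∀ p ∈ S, p ∣ m i → p ∣ m j → False) : J.card ≤ S.card := by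
  choose! f hf hfm using h1
  refine Finset.card_le_card_of_injOn f hf ?_
  intro i hi j hj hij
  by_contra hne
  exact h2 i hi j hj hne (f i) (hf i hi) (hfm i hi) (hij ▸ hfm j hj)

namespace Ctx
variable {ι : Type} {I : Finset ι} {a : ι → ℤ} {m : ι → ℕ} {N : ℕ}

theorem row' (h : Ctx I a m N) (J : Finset ι) (hJ : J ⊆ I) (n B : ℕ) (hn : 0 < n) (hB : B < N)
    (hd : ∀ i ∈ J, n ∣ m i) (hc : ∀ i ∈ J, ∀ j ∈ J, a i % (n : ℤ) = a j % n)
    (hg : ∀ i ∈ J, ∀ j ∈ J, i ≠ j → Nat.gcd (m i) (m j) < n * (B + 1)) : J.card ≤ max 1 B :=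
  row (h.ih B hB) J a m hn (fun i hi => h.pos i (hJ hi)) hd hc hg
    (fun i hi j hj => h.nd i (hJ hi) j (hJ hj))

theorem row0 (h : Ctx I a m N) (J : Finset ι) (hJ : J ⊆ I) (n : ℕ) (hn : 2 ≤ n)
    (hd : ∀ i ∈ J, n ∣ m i) (hc : ∀ i ∈ J, ∀ j ∈ J, a i % (n : ℤ) = a j % n) :
    J.card ≤ max 1 (N / n) := by
  have := h.two
  refine h.row' J hJ n (N / n) (by omega) (Nat.div_lt_self (by omega) (by omega)) hd hc ?_
  intro i hi j hj hij
  exact lt_of_le_of_lt (h.le i (hJ hi) j (hJ hj) hij) (Nat.lt_mul_div_succ N (by omega))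

theorem rowW (h : Ctx I a m N) (J : Finset ι) (hJ : J ⊆ I) (n : ℕ) (hn : 2 ≤ n)
    (W : Finset ℤ) (hW : W ⊆ Finset.Ico 0 (n : ℤ))
    (hd : ∀ i ∈ J, n ∣ m i) (h1 : ∀ i ∈ J, a i % (n : ℤ) ∉ W) :
    J.card ≤ max 1 (N / n) * (n - W.card) := by
  refine cls J a n (by omega) W hW _ h1 ?_
  intro r
  refine h.row0 _ ((Finset.filter_subset _ _).trans hJ) n hn ?_ ?_
  · intro i hi; exact hd i (Finset.mem_filter.1 hi).1
  · intro i hi j hj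
    rw [(Finset.mem_filter.1 hi).2, (Finset.mem_filter.1 hj).2]

theorem dle (h : Ctx I a m N) {i j : ι} (hi : i ∈ I) (hj : j ∈ I) (hij : i ≠ j) (d : ℕ)
    (h1 : d ∣ m i) (h2 : d ∣ m j) : d ≤ N :=
  (Nat.le_of_dvd (Nat.gcd_pos_of_pos_left _ (h.pos i hi)) (Nat.dvd_gcd h1 h2)).trans
    (h.le i hi j hj hij)

theorem one (h : Ctx I a m N) (J : Finset ι) (hJ : J ⊆ I) (d : ℕ) (hd : N < d)
    (h1 : ∀ i ∈ J, d ∣ m i) : J.card ≤ 1 := by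
  rw [Finset.card_le_one]
  intro i hi j hj
  by_contra hne
  have := h.dle (hJ hi) (hJ hj) hne d (h1 i hi) (h1 j hj)
  omega

theorem gt1 (h : Ctx I a m N) {i j : ι} (hi : i ∈ I) (hj : j ∈ I) (hij : i ≠ j) :
    1 < Nat.gcd (m i) (m j) := by
  have h1 := Nat.gcd_pos_of_pos_left (m j) (h.pos i hi)
  have h2 : Nat.gcd (m i) (m j) ≠ 1 := by
    intro h0
    apply h.nd i hi j hj hij
    rw [h0]; simp
  omega

theorem dvdL (h : Ctx I a m N) {i : ι} (hi : i ∈ I) : m i ∣ 232792560 :=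
  (h.dvd i hi).trans (LN_dvd N h.N19)

theorem ple (h : Ctx I a m N) {i : ι} (hi : i ∈ I) {p : ℕ} (hp : p.Prime) (hd : p ∣ m i) :
    p ≤ N := LN_prime_le N p hp (hd.trans (h.dvd i hi))

theorem primes {p : ℕ} (hp : p.Prime) (hd : p ∣ 232792560) :
    p = 2 ∨ p = 3 ∨ p = 5 ∨ p = 7 ∨ p = 11 ∨ p = 13 ∨ p = 17 ∨ p = 19 := by
  have h19 : p ≤ 19 := LN_prime_le 19 p hp hd
  interval_cases p <;> revert hp <;> decide

/-- a common prime -/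
theorem cp (h : Ctx I a m N) {i j : ι} (hi : i ∈ I) (hj : j ∈ I) (hij : i ≠ j) :
    ∃ p, p.Prime ∧ p ∣ m i ∧ p ∣ m j ∧ p ≤ N ∧
      (p = 2 ∨ p = 3 ∨ p = 5 ∨ p = 7 ∨ p = 11 ∨ p = 13 ∨ p = 17 ∨ p = 19) := by
  obtain ⟨p, hp, hd⟩ := Nat.exists_prime_and_dvd (h.gt1 hi hj hij).ne'
  have h1 := hd.trans (Nat.gcd_dvd_left _ _)
  exact ⟨p, hp, h1, hd.trans (Nat.gcd_dvd_right _ _), h.ple hi hp h1,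
    primes hp (h1.trans (h.dvdL hi))⟩

theorem pp (h : Ctx I a m N) {i : ι} (hi : i ∈ I) (p : ℕ) (hp : p.Prime) (hpN : p ≤ N) :
    ∃ q, q.Prime ∧ q ≠ p ∧ q ∣ m i ∧ q ≤ N ∧
      (q = 2 ∨ q = 3 ∨ q = 5 ∨ q = 7 ∨ q = 11 ∨ q = 13 ∨ q = 17 ∨ q = 19) := by
  obtain ⟨j, hj, hd⟩ := h.ex p hp.two_le hpN
  by_cases hij : i = j
  · subst hij
    have h1 : m i ≠ 1 := by
      intro h1
      have hb := h.big
      have h2 := h.two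
      obtain ⟨j, hj, hji⟩ := Finset.exists_mem_ne (by omega : 1 < I.card) i
      have := h.gt1 hi hj hji.symm
      rw [h1] at this
      simp at this
    obtain ⟨q, hq, hqd⟩ := Nat.exists_prime_and_dvd h1
    exact ⟨q, hq, fun hh => hd (hh ▸ hqd), hqd, h.ple hi hq hqd,
      primes hq (hqd.trans (h.dvdL hi))⟩
  · obtain ⟨q, hq, h1, h2, h3, h4⟩ := h.cp hi hj hij
    exact ⟨q, hq, fun hh => hd (hh ▸ h2), h1, h3, h4⟩

theorem sep (h : Ctx I a m N) {i j : ι} (hi : i ∈ I) (hj : j ∈ I) (hij : i ≠ j) :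
    ∃ q, (q = 2 ∨ q = 4 ∨ q = 8 ∨ q = 16 ∨ q = 3 ∨ q = 9 ∨ q = 5 ∨ q = 7 ∨ q = 11 ∨ q = 13 ∨
      q = 17 ∨ q = 19) ∧ q ∣ m i ∧ q ∣ m j ∧ ¬ (q : ℤ) ∣ a i - a j := by
  by_contra hcon
  push Not at hcon
  apply h.nd i hi j hj hij
  have hgN := (h.le i hi j hj hij).trans h.N19
  have hg1 := h.gt1 hi hj hij
  have hgi := Nat.gcd_dvd_left (m i) (m j)
  have hgj := Nat.gcd_dvd_right (m i) (m j)
  generalize Nat.gcd (m i) (m j) = g at *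
  have key : ∀ q : ℕ, (q = 2 ∨ q = 4 ∨ q = 8 ∨ q = 16 ∨ q = 3 ∨ q = 9 ∨ q = 5 ∨ q = 7 ∨ q = 11 ∨
      q = 13 ∨ q = 17 ∨ q = 19) → q ∣ g → (q : ℤ) ∣ a i - a j := fun q hq hd =>
    hcon q hq (hd.trans hgi) (hd.trans hgj)
  generalize a i - a j = x at *
  clear hcon hgi hgj
  have k2 := key 2; have k3 := key 3; have k4 := key 4; have k5 := key 5
  have k7 := key 7; have k8 := key 8; have k9 := key 9; have k11 := key 11
  have k13 := key 13; have k16 := key 16; have k17 := key 17; have k19 := key 19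
  clear key
  interval_cases g <;> norm_num at * <;> omega

theorem sepn (h : Ctx I a m N) {i j : ι} (hi : i ∈ I) (hj : j ∈ I) (hij : i ≠ j) (n : ℕ)
    (h1 : n ∣ m i) (h2 : n ∣ m j) :
    ∃ q, (q = 2 ∨ q = 4 ∨ q = 8 ∨ q = 16 ∨ q = 3 ∨ q = 9 ∨ q = 5 ∨ q = 7 ∨ q = 11 ∨ q = 13 ∨
      q = 17 ∨ q = 19) ∧ q ∣ m i ∧ q ∣ m j ∧ ¬ (q : ℤ) ∣ a i - a j ∧ Nat.lcm n q ≤ N := by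
  obtain ⟨q, hq, h3, h4, h5⟩ := h.sep hi hj hij
  exact ⟨q, hq, h3, h4, h5, h.dle hi hj hij _ (Nat.lcm_dvd h1 h3) (Nat.lcm_dvd h2 h4)⟩

theorem sep7 (h : Ctx I a m N) {i j : ι} (hi : i ∈ I) (hj : j ∈ I) (hij : i ≠ j)
    (h1 : 7 ∣ m i) (h2 : 7 ∣ m j) (h3 : a i % 7 = a j % 7) :
    2 ∣ m i ∧ 2 ∣ m j ∧ a i % 2 ≠ a j % 2 := by
  have hN := h.N19
  obtain ⟨q, hq, h4, h5, h6, h7⟩ := h.sepn hi hj hij 7 h1 h2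
  rcases hq with rfl | rfl | rfl | rfl | rfl | rfl | rfl | rfl | rfl | rfl | rfl | rfl <;>
    norm_num [Nat.lcm] at * <;> omega

theorem sep5 (h : Ctx I a m N) {i j : ι} (hi : i ∈ I) (hj : j ∈ I) (hij : i ≠ j)
    (h1 : 5 ∣ m i) (h2 : 5 ∣ m j) (h3 : a i % 5 = a j % 5) :
    (2 ∣ m i ∧ 2 ∣ m j ∧ a i % 2 ≠ a j % 2) ∨
      (15 ≤ N ∧ 3 ∣ m i ∧ 3 ∣ m j ∧ a i % 3 ≠ a j % 3) := by
  have hN := h.N19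
  obtain ⟨q, hq, h4, h5, h6, h7⟩ := h.sepn hi hj hij 5 h1 h2
  rcases hq with rfl | rfl | rfl | rfl | rfl | rfl | rfl | rfl | rfl | rfl | rfl | rfl <;>
    norm_num [Nat.lcm] at * <;> omega

theorem nobig (h : Ctx I a m N) {i : ι} (hi : i ∈ I)
    (hb : ∀ p ∈ ({7, 11, 13, 17, 19} : Finset ℕ), ¬ p ∣ m i) : m i ∣ 720 := by
  have h1 : Nat.Coprime (m i) (7 * 11 * 13 * 17 * 19) := by
    simp only [Finset.mem_insert, Finset.mem_singleton, forall_eq_or_imp, forall_eq] at hb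
    obtain ⟨h7, h11, h13, h17, h19⟩ := hb
    refine Nat.Coprime.mul_right (Nat.Coprime.mul_right (Nat.Coprime.mul_right
      (Nat.Coprime.mul_right ?_ ?_) ?_) ?_) ?_
    all_goals
      rw [Nat.coprime_comm]
      refine (Nat.Prime.coprime_iff_not_dvd (by norm_num)).2 (by assumption)
  have h2 : m i ∣ 720 * (7 * 11 * 13 * 17 * 19) := by
    have := h.dvdL hi
    norm_num
    exact this
  exact h1.dvd_of_dvd_mul_right h2

/-- big primes up to `N` -/
def bp (N : ℕ) : Finset ℕ := ({7, 11, 13, 17, 19} : Finset ℕ).filter (· ≤ N)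

theorem bp_prime {p : ℕ} (hp : p ∈ bp N) : p.Prime ∧ 7 ≤ p := by
  simp only [bp, Finset.mem_filter, Finset.mem_insert, Finset.mem_singleton] at hp
  rcases hp with ⟨rfl | rfl | rfl | rfl | rfl, _⟩ <;> norm_num

theorem nobig' (h : Ctx I a m N) {i : ι} (hi : i ∈ I)
    (hb : ∀ p ∈ bp N, ¬ p ∣ m i) : m i ∣ 720 := by
  apply h.nobig hi
  intro p hp hpd
  refine hb p ?_ hpd
  have hpp : p.Prime := by
    simp only [Finset.mem_insert, Finset.mem_singleton] at hp
    rcases hp with rfl | rfl | rfl | rfl | rfl <;> norm_num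
  exact Finset.mem_filter.2 ⟨hp, h.ple hi hpp hpd⟩

/-- two coprime divisors -/
theorem dle2 (h : Ctx I a m N) {i j : ι} (hi : i ∈ I) (hj : j ∈ I) (hij : i ≠ j) (d e : ℕ)
    (hc : Nat.Coprime d e)
    (h1 : d ∣ m i) (h2 : d ∣ m j) (h3 : e ∣ m i) (h4 : e ∣ m j) : d * e ≤ N :=
  h.dle hi hj hij _ (hc.mul_dvd_of_dvd_of_dvd h1 h3) (hc.mul_dvd_of_dvd_of_dvd h2 h4)

end Ctx
end DC

namespace DC
namespace Ctx
variable {ι : Type} {I : Finset ι} {a : ι → ℤ} {m : ι → ℕ} {N : ℕ}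

/-! ### Part 3: representatives 14 and 10 -/

theorem half (h : Ctx I a m N) (r : ℤ) (hr : r = 0 ∨ r = 1) (J : Finset ι) (hJ : J ⊆ I)
    (h1 : ∀ i ∈ J, 2 ∣ m i ∧ a i % 2 ≠ r) : J.card ≤ N / 2 := by
  have h2 := h.two
  have := h.rowW J hJ 2 le_rfl {r} (by rcases hr with rfl | rfl <;> simp) (fun i hi => (h1 i hi).1)
    (fun i hi => by simpa using (h1 i hi).2)
  simp at this
  omega

theorem P14 (h : Ctx I a m N) (hN : 14 ≤ N) (i0 : ι) (hi0 : i0 ∈ I) (hm0 : m i0 = 14) :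
    False := by
  classical
  have hb := h.big
  have e := Finset.card_filter_add_card_filter_not (s := I)
    (fun i => 2 ∣ m i ∧ a i % 2 ≠ a i0 % 2)
  have h1 := h.half (a i0 % 2) (by omega) (I.filter fun i => 2 ∣ m i ∧ a i % 2 ≠ a i0 % 2)
    (Finset.filter_subset _ _) (fun i hi => (Finset.mem_filter.1 hi).2)
  have h7 : ∀ i ∈ I, ¬ (2 ∣ m i ∧ a i % 2 ≠ a i0 % 2) → 7 ∣ m i := by
    intro i hi hn
    by_cases hii : i = i0
    · subst hii; omega
    obtain ⟨q, hq, h4, h5, h6⟩ := h.sep hi hi0 hii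
    rw [hm0] at h5
    rcases hq with rfl | rfl | rfl | rfl | rfl | rfl | rfl | rfl | rfl | rfl | rfl | rfl <;>
      norm_num at * <;> omega
  have h2 : (I.filter fun i => ¬ (2 ∣ m i ∧ a i % 2 ≠ a i0 % 2)).card ≤ 1 * (7 - (∅ : Finset ℤ).card) := by
    refine cls _ a 7 (by norm_num) ∅ (by simp) 1 (by simp) ?_
    intro r
    rw [Finset.card_le_one]
    intro i hi j hj
    by_contra hij
    simp only [Finset.mem_filter] at hi hj
    obtain ⟨⟨hi, hi2⟩, hi3⟩ := hi
    obtain ⟨⟨hj, hj2⟩, hj3⟩ := hj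
    have := h.sep7 hi hj hij (h7 i hi hi2) (h7 j hj hj2) (by norm_num at hi3 hj3; omega)
    omega
  rw [Finset.card_empty] at h2
  omega

theorem d720 : ∀ x ∈ Nat.divisors 720, ¬ 2 ∣ x → 3 ∣ x → x ≠ 3 → x ≠ 9 → x ≠ 15 → 45 ∣ x := by
  decide +kernel

/-- odd multiples of 15 other than 15, pairwise without big common primes -/
theorem odd15 (h : Ctx I a m N) (hno : ∀ i ∈ I, m i ≠ 15) (J : Finset ι) (hJ : J ⊆ I)
    (h1 : ∀ i ∈ J, 3 ∣ m i ∧ 5 ∣ m i) (h2 : ∀ i ∈ J, ¬ 2 ∣ m i) :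
    J.card ≤ (bp N).card + 1 := by
  classical
  have hN := h.N19
  have e := Finset.card_filter_add_card_filter_not (s := J) (fun i => ∃ p ∈ bp N, p ∣ m i)
  have e1 : (J.filter fun i => ∃ p ∈ bp N, p ∣ m i).card ≤ (bp N).card := by
    refine strip _ m _ (fun i hi => (Finset.mem_filter.1 hi).2) ?_
    intro i hi j hj hij p hp hpi hpj
    have hi := (Finset.mem_filter.1 hi).1
    have hj := (Finset.mem_filter.1 hj).1
    have h7 := bp_prime hp
    have h15 : ∀ i ∈ J, 15 ∣ m i := fun i hi => by have := h1 i hi; omega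
    have := h.dle2 (hJ hi) (hJ hj) hij 15 p (by
      rw [Nat.coprime_comm, Nat.Prime.coprime_iff_not_dvd h7.1]
      intro hh
      have : p ∈ Nat.divisors 15 := by simp [hh]
      have h15 : ∀ p ∈ Nat.divisors 15, 7 ≤ p → p = 15 := by decide
      have := h15 p this h7.2
      subst this
      exact absurd h7.1 (by norm_num)) (h15 i hi) (h15 j hj) hpi hpj
    omega
  have e2 : (J.filter fun i => ¬ ∃ p ∈ bp N, p ∣ m i).card ≤ 1 := by
    refine h.one _ ((Finset.filter_subset _ _).trans hJ) 45 (by omega) ?_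
    intro i hi
    obtain ⟨hi, hi2⟩ := Finset.mem_filter.1 hi
    push Not at hi2
    have := h.nobig' (hJ hi) hi2
    have h15 := h1 i hi
    exact d720 _ (by simp [this]) (h2 i hi) h15.1 (by omega) (by omega) (hno i (hJ hi))
  omega

theorem bp_card (h15 : 15 ≤ N) (h19 : N ≤ 19) : N / 2 + 5 + (bp N).card ≤ N := by
  interval_cases N <;> decide

theorem P10 (h : Ctx I a m N) (hN : 10 ≤ N) (hno : 15 ≤ N → ∀ i ∈ I, m i ≠ 15)
    (i0 : ι) (hi0 : i0 ∈ I) (hm0 : m i0 = 10) : False := by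
  classical
  have hb := h.big
  have h19 := h.N19
  have e := Finset.card_filter_add_card_filter_not (s := I)
    (fun i => 2 ∣ m i ∧ a i % 2 ≠ a i0 % 2)
  have h1 := h.half (a i0 % 2) (by omega) (I.filter fun i => 2 ∣ m i ∧ a i % 2 ≠ a i0 % 2)
    (Finset.filter_subset _ _) (fun i hi => (Finset.mem_filter.1 hi).2)
  have h5 : ∀ i ∈ I, ¬ (2 ∣ m i ∧ a i % 2 ≠ a i0 % 2) → 5 ∣ m i := by
    intro i hi hn
    by_cases hii : i = i0
    · subst hii; omega
    obtain ⟨q, hq, h4, h5, h6⟩ := h.sep hi hi0 hii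
    rw [hm0] at h5
    rcases hq with rfl | rfl | rfl | rfl | rfl | rfl | rfl | rfl | rfl | rfl | rfl | rfl <;>
      norm_num at * <;> omega
  set F := I.filter fun i => ¬ (2 ∣ m i ∧ a i % 2 ≠ a i0 % 2) with hF
  have hFI : F ⊆ I := Finset.filter_subset _ _
  have hF5 : ∀ i ∈ F, 5 ∣ m i := fun i hi => h5 i (hFI hi) (Finset.mem_filter.1 hi).2
  have hFs : ∀ i ∈ F, ∀ j ∈ F, i ≠ j → a i % 5 = a j % 5 → 15 ≤ N ∧ 3 ∣ m i ∧ 3 ∣ m j := by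
    intro i hi j hj hij h0
    have hi2 := (Finset.mem_filter.1 hi).2
    have hj2 := (Finset.mem_filter.1 hj).2
    rcases h.sep5 (hFI hi) (hFI hj) hij (hF5 i hi) (hF5 j hj) h0 with h3 | h3
    · omega
    · exact ⟨h3.1, h3.2.1, h3.2.2.1⟩
  rcases lt_or_ge N 15 with hN15 | hN15
  · have h2 : F.card ≤ 1 * (5 - (∅ : Finset ℤ).card) := by
      refine cls _ a 5 (by norm_num) ∅ (by simp) 1 (by simp) ?_
      intro r
      rw [Finset.card_le_one]
      intro i hi j hj
      by_contra hij
      simp only [Finset.mem_filter] at hi hj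
      have := hFs i hi.1 j hj.1 hij (by have := hi.2; have := hj.2; norm_num at *; omega)
      omega
    simp at h2
    omega
  · have hbp := bp_card hN15 h19
    have e2 := Finset.card_filter_add_card_filter_not (s := F) (fun i => 3 ∣ m i)
    set F3 := F.filter fun i => 3 ∣ m i with hF3
    set Fn := F.filter fun i => ¬ 3 ∣ m i with hFn
    set X := F3.image fun i => a i % 5 with hX
    have hXs : X ⊆ Finset.Ico 0 ((5 : ℕ) : ℤ) := by
      intro r hr
      obtain ⟨i, hi, rfl⟩ := Finset.mem_image.1 hr
      simp only [Finset.mem_Ico]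
      norm_num
      omega
    have hX5 : X.card ≤ 5 := by simpa using Finset.card_le_card hXs
    have h2 : Fn.card ≤ 1 * (5 - X.card) := by
      refine cls _ a 5 (by norm_num) X hXs 1 ?_ ?_
      · intro i hi hiX
        obtain ⟨j, hj, hij⟩ := Finset.mem_image.1 hiX
        simp only [hFn, hF3, Finset.mem_filter] at hi hj
        have := hFs i hi.1 j hj.1 (by rintro rfl; exact hi.2 hj.2) (by norm_num at *; omega)
        exact hi.2 this.2.1
      · intro r
        rw [Finset.card_le_one]
        intro i hi j hj
        by_contra hij
        simp only [Finset.mem_filter, hFn] at hi hj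
        have := hFs i hi.1.1 j hj.1.1 hij (by have := hi.2; have := hj.2; norm_num at *; omega)
        exact hi.1.2 this.2.1
    have hF3I : F3 ⊆ I := (Finset.filter_subset _ _).trans hFI
    have h3 : F3.card ≤ 3 * X.card := by
      refine Finset.card_le_mul_card_image (f := fun i => a i % 5) F3 3 ?_
      intro r _
      have := h.row0 (F3.filter fun i => a i % 5 = r) ((Finset.filter_subset _ _).trans hF3I) 5
        (by norm_num) (fun i hi => hF5 i (by simp [hF3] at hi; tauto)) (by
          intro i hi j hj
          have := (Finset.mem_filter.1 hi).2
          have := (Finset.mem_filter.1 hj).2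
          norm_num at *; omega)
      omega
    have e3 := Finset.card_filter_add_card_filter_not (s := F3) (fun i => 2 ∣ m i)
    have h4 := h.odd15 (hno hN15) (F3.filter fun i => ¬ 2 ∣ m i) ((Finset.filter_subset _ _).trans hF3I)
      (fun i hi => by
        simp only [hF3, Finset.mem_filter] at hi
        exact ⟨hi.1.2, hF5 i hi.1.1⟩) (fun i hi => (Finset.mem_filter.1 hi).2)
    have h6 := h.one (F3.filter fun i => 2 ∣ m i) ((Finset.filter_subset _ _).trans hF3I) 30
      (by omega) (fun i hi => by
        simp only [hF3, Finset.mem_filter] at hi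
        have := hF5 i hi.1.1
        omega)
    omega
end Ctx
end DC

namespace DC
namespace Ctx
variable {ι : Type} {I : Finset ι} {a : ι → ℤ} {m : ι → ℕ} {N : ℕ}

/-! ### Part 4: representative 15 -/

theorem no30 (h : Ctx I a m N) {i j : ι} (hi : i ∈ I) (hj : j ∈ I) (hij : i ≠ j)
    (h1 : 30 ∣ m i) (h2 : 30 ∣ m j) : False := by
  have := h.dle hi hj hij 30 h1 h2
  have := h.N19
  omega

theorem no20 (h : Ctx I a m N) {i j : ι} (hi : i ∈ I) (hj : j ∈ I) (hij : i ≠ j)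
    (h1 : 20 ∣ m i) (h2 : 20 ∣ m j) : False := by
  have := h.dle hi hj hij 20 h1 h2
  have := h.N19
  omega

theorem no45 (h : Ctx I a m N) {i j : ι} (hi : i ∈ I) (hj : j ∈ I) (hij : i ≠ j)
    (h1 : 45 ∣ m i) (h2 : 45 ∣ m j) : False := by
  have := h.dle hi hj hij 45 h1 h2
  have := h.N19
  omega

/-- an element with odd modulus `3·5·…` not divisible by 9 against one without 5 -/
theorem sepC (h : Ctx I a m N) {i c : ι} (hi : i ∈ I) (hc : c ∈ I) (h3 : 3 ∣ m i)
    (h5 : ¬ 5 ∣ m i) (c3 : 3 ∣ m c) (c5 : 5 ∣ m c) (c2 : ¬ 2 ∣ m c) (c9 : ¬ 9 ∣ m c) :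
    a i % 3 ≠ a c % 3 := by
  have hN := h.N19
  have hij : i ≠ c := by rintro rfl; exact h5 c5
  obtain ⟨q, hq, h4, h5, h6, h7⟩ := h.sepn hi hc hij 3 h3 c3
  rcases hq with rfl | rfl | rfl | rfl | rfl | rfl | rfl | rfl | rfl | rfl | rfl | rfl <;>
    norm_num [Nat.lcm] at * <;> omega

theorem or35 (h : Ctx I a m N) {i i0 : ι} (hi : i ∈ I) (hi0 : i0 ∈ I) (hm0 : m i0 = 15) :
    3 ∣ m i ∨ 5 ∣ m i := by
  by_cases hii : i = i0
  · subst hii; omega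
  obtain ⟨q, hq, h4, h5, h6⟩ := h.sep hi hi0 hii
  rw [hm0] at h5
  rcases hq with rfl | rfl | rfl | rfl | rfl | rfl | rfl | rfl | rfl | rfl | rfl | rfl <;>
    norm_num at * <;> omega

theorem P15a (h : Ctx I a m N) (hN : 15 ≤ N) (i0 : ι) (hi0 : i0 ∈ I) (hm0 : m i0 = 15)
    (c : ι) (hc : c ∈ I) (c3 : 3 ∣ m c) (c5 : 5 ∣ m c) (c2 : ¬ 2 ∣ m c) (c9 : ¬ 9 ∣ m c)
    (hne : a c % 3 ≠ a i0 % 3) : False := by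
  classical
  have hb := h.big
  have e := Finset.card_filter_add_card_filter_not (s := I)
    (fun i => 3 ∣ m i ∧ a i % 3 ≠ a i0 % 3 ∧ a i % 3 ≠ a c % 3)
  have h1 := h.row0 (I.filter fun i => 3 ∣ m i ∧ a i % 3 ≠ a i0 % 3 ∧ a i % 3 ≠ a c % 3)
    (Finset.filter_subset _ _) 3 (by norm_num) (fun i hi => (Finset.mem_filter.1 hi).2.1) (by
      intro i hi j hj
      simp only [Finset.mem_filter] at hi hj
      norm_num
      omega)
  set F := I.filter fun i => ¬ (3 ∣ m i ∧ a i % 3 ≠ a i0 % 3 ∧ a i % 3 ≠ a c % 3) with hF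
  have hFI : F ⊆ I := Finset.filter_subset _ _
  have hF3 : ∀ i ∈ F, 3 ∣ m i → a i % 3 = a i0 % 3 ∨ a i % 3 = a c % 3 := by
    intro i hi
    have := (Finset.mem_filter.1 hi).2
    omega
  have hF5 : ∀ i ∈ F, 5 ∣ m i := by
    intro i hi
    by_contra h5
    have h3 := (h.or35 (hFI hi) hi0 hm0).resolve_right h5
    have k1 := h.sepC (hFI hi) hi0 h3 h5 (by omega) (by omega) (by omega) (by omega)
    have k2 := h.sepC (hFI hi) hc h3 h5 c3 c5 c2 c9
    have := hF3 i hi h3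
    omega
  have h2 : F.card ≤ 2 * (5 - (∅ : Finset ℤ).card) := by
    refine cls _ a 5 (by norm_num) ∅ (by simp) 2 (by simp) ?_
    intro r
    by_contra hlt
    push Not at hlt
    obtain ⟨x, hx, y, hy, z, hz, hxy, hxz, hyz⟩ := Finset.two_lt_card.1 hlt
    simp only [Finset.mem_filter] at hx hy hz
    obtain ⟨hx, hxr⟩ := hx
    obtain ⟨hy, hyr⟩ := hy
    obtain ⟨hz, hzr⟩ := hz
    norm_num at hxr hyr hzr
    have x5 := hF5 x hx
    have y5 := hF5 y hy
    have z5 := hF5 z hz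
    have x3 := hF3 x hx
    have y3 := hF3 y hy
    have z3 := hF3 z hz
    have k1 := h.sep5 (hFI hx) (hFI hy) hxy x5 y5 (by omega)
    have k2 := h.sep5 (hFI hx) (hFI hz) hxz x5 z5 (by omega)
    have k3 := h.sep5 (hFI hy) (hFI hz) hyz y5 z5 (by omega)
    have n1 : ¬ (30 ∣ m x ∧ 30 ∣ m y) := fun hh => h.no30 (hFI hx) (hFI hy) hxy hh.1 hh.2
    have n2 : ¬ (30 ∣ m x ∧ 30 ∣ m z) := fun hh => h.no30 (hFI hx) (hFI hz) hxz hh.1 hh.2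
    have n3 : ¬ (30 ∣ m y ∧ 30 ∣ m z) := fun hh => h.no30 (hFI hy) (hFI hz) hyz hh.1 hh.2
    have t : ∀ u : ℕ, 5 ∣ u → 2 ∣ u → 3 ∣ u → 30 ∣ u := by intros; omega
    have tx := t _ x5
    have ty := t _ y5
    have tz := t _ z5
    rcases k1 with ⟨p1, p2, p3⟩ | ⟨_, p1, p2, p3⟩ <;>
    rcases k2 with ⟨q1, q2, q3⟩ | ⟨_, q1, q2, q3⟩ <;>
    rcases k3 with ⟨s1, s2, s3⟩ | ⟨_, s1, s2, s3⟩
    · omega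
    · exact n3 ⟨ty p2 s1, tz q2 s2⟩
    · exact n2 ⟨tx p1 q1, tz s2 q2⟩
    · exact n1 ⟨tx p1 q1, ty p2 s1⟩
    · exact n1 ⟨tx q1 p1, ty s1 p2⟩
    · exact n2 ⟨tx q1 p1, tz q2 s2⟩
    · exact n3 ⟨ty s1 p2, tz s2 q2⟩
    · have := x3 p1; have := y3 p2; have := z3 q2; omega
  rw [Finset.card_empty] at h2
  omega

theorem d720b : ∀ x ∈ Nat.divisors 720, 5 ∣ x → ¬ 3 ∣ x → x ≠ 5 → x ≠ 10 → 20 ∣ x := by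
  decide +kernel

/-- multiples of 5, not of 3, and not equal to 10 -/
theorem w5 (h : Ctx I a m N) (hno : ∀ i ∈ I, m i ≠ 10) (J : Finset ι) (hJ : J ⊆ I)
    (h1 : ∀ i ∈ J, 5 ∣ m i ∧ ¬ 3 ∣ m i) : J.card ≤ (bp N).card + 1 := by
  classical
  have hN := h.N19
  have e := Finset.card_filter_add_card_filter_not (s := J) (fun i => ∃ p ∈ bp N, p ∣ m i)
  have e1 : (J.filter fun i => ∃ p ∈ bp N, p ∣ m i).card ≤ (bp N).card := by
    refine strip _ m _ (fun i hi => (Finset.mem_filter.1 hi).2) ?_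
    intro i hi j hj hij p hp hpi hpj
    have hi := (Finset.mem_filter.1 hi).1
    have hj := (Finset.mem_filter.1 hj).1
    have h7 := bp_prime hp
    have := h.dle2 (hJ hi) (hJ hj) hij 5 p (by
      rw [Nat.coprime_primes (by norm_num) h7.1]
      omega) (h1 i hi).1 (h1 j hj).1 hpi hpj
    omega
  have e2 : (J.filter fun i => ¬ ∃ p ∈ bp N, p ∣ m i).card ≤ 1 := by
    refine h.one _ ((Finset.filter_subset _ _).trans hJ) 20 (by omega) ?_
    intro i hi
    obtain ⟨hi, hi2⟩ := Finset.mem_filter.1 hi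
    push Not at hi2
    have := h.nobig' (hJ hi) hi2
    have h15 := h1 i hi
    refine d720b _ (by simp [this]) h15.1 h15.2 ?_ (hno i (hJ hi))
    intro h5
    obtain ⟨q, hq, hq5, hqd, _, _⟩ := h.pp (hJ hi) 5 (by norm_num)
      (h.ple (hJ hi) (by norm_num) h15.1)
    rw [h5, Nat.prime_dvd_prime_iff_eq hq (by norm_num)] at hqd
    exact hq5 hqd
  omega

end Ctx
end DC

namespace DC
namespace Ctx
variable {ι : Type} {I : Finset ι} {a : ι → ℤ} {m : ι → ℕ} {N : ℕ}

theorem card3 (J : Finset ι) (a : ι → ℤ) (hc : ∀ i ∈ J, ∀ j ∈ J, a i % 3 = a j % 3)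
    (hd : ∀ i ∈ J, ∀ j ∈ J, i ≠ j → a i % 9 ≠ a j % 9) : J.card ≤ 3 := by
  classical
  rcases J.eq_empty_or_nonempty with rfl | ⟨i0, hi0⟩
  · simp
  have : J.card ≤ ({a i0 % 3, a i0 % 3 + 3, a i0 % 3 + 6} : Finset ℤ).card := by
    refine Finset.card_le_card_of_injOn (fun i => a i % 9) ?_ ?_
    · intro i hi
      have := hc i hi i0 hi0
      simp only [Finset.coe_insert, Finset.coe_singleton, Set.mem_insert_iff,
        Set.mem_singleton_iff]
      omega
    · intro i hi j hj hij
      by_contra hne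
      exact hd i hi j hj hne hij
  exact this.trans Finset.card_le_three

set_option maxHeartbeats 4000000 in
theorem P15b (h : Ctx I a m N) (hN : 15 ≤ N) (i0 : ι) (hi0 : i0 ∈ I) (hm0 : m i0 = 15)
    (hC : ∀ c ∈ I, 3 ∣ m c → 5 ∣ m c → ¬ 2 ∣ m c → ¬ 9 ∣ m c → a c % 3 = a i0 % 3) : False := by
  classical
  have hb := h.big
  have h19 := h.N19
  have e := Finset.card_filter_add_card_filter_not (s := I)
    (fun i => 3 ∣ m i ∧ a i % 3 ≠ a i0 % 3)
  set G := I.filter fun i => 3 ∣ m i ∧ a i % 3 ≠ a i0 % 3 with hG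
  set F := I.filter fun i => ¬ (3 ∣ m i ∧ a i % 3 ≠ a i0 % 3) with hF
  have hGI : G ⊆ I := Finset.filter_subset _ _
  have hFI : F ⊆ I := Finset.filter_subset _ _
  have hF3 : ∀ i ∈ F, 3 ∣ m i → a i % 3 = a i0 % 3 := by
    intro i hi
    have := (Finset.mem_filter.1 hi).2
    omega
  have hF5 : ∀ i ∈ F, 5 ∣ m i := by
    intro i hi
    by_contra h5
    have h3 := (h.or35 (hFI hi) hi0 hm0).resolve_right h5
    have k1 := h.sepC (hFI hi) hi0 h3 h5 (by omega) (by omega) (by omega) (by omega)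
    exact k1 (hF3 i hi h3)
  have hG3 : ∀ i ∈ G, 3 ∣ m i ∧ a i % 3 ≠ a i0 % 3 := fun i hi => (Finset.mem_filter.1 hi).2
  -- elements of G with 5
  have hG5 : ∀ i ∈ G, 5 ∣ m i → ¬ 30 ∣ m i → 45 ∣ m i ∧ ¬ 2 ∣ m i := by
    intro i hi h5 h30
    have h3 := hG3 i hi
    have h2 : ¬ 2 ∣ m i := by omega
    have h9 : 9 ∣ m i := by
      by_contra h9
      exact h3.2 (hC i (hGI hi) h3.1 h5 h2 h9)
    exact ⟨by omega, h2⟩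
  -- pairs in F
  have hFp : ∀ i ∈ F, ∀ j ∈ F, i ≠ j → a i % 5 = a j % 5 →
      2 ∣ m i ∧ 2 ∣ m j ∧ a i % 2 ≠ a j % 2 := by
    intro i hi j hj hij h0
    rcases h.sep5 (hFI hi) (hFI hj) hij (hF5 i hi) (hF5 j hj) h0 with h3 | ⟨_, h3, h4, h5⟩
    · exact h3
    · have := hF3 i hi h3
      have := hF3 j hj h4
      omega
  -- the bound on F
  have eF := Finset.card_filter_add_card_filter_not (s := F) (fun i => 3 ∣ m i ∧ ¬ 2 ∣ m i)
  set Co := F.filter fun i => 3 ∣ m i ∧ ¬ 2 ∣ m i with hCo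
  set W' := F.filter fun i => ¬ (3 ∣ m i ∧ ¬ 2 ∣ m i) with hW'
  have hCo1 : 1 ≤ Co.card := by
    refine Finset.card_pos.2 ⟨i0, ?_⟩
    simp only [hCo, hF, Finset.mem_filter]
    exact ⟨⟨hi0, by omega⟩, by omega, by omega⟩
  set X := Co.image fun i => a i % 5 with hX
  have hXc : X.card = Co.card := by
    refine Finset.card_image_of_injOn ?_
    intro i hi j hj hij
    by_contra hne
    simp only [hCo, Finset.coe_filter, Set.mem_ofPred_eq] at hi hj
    have := hFp i hi.1 j hj.1 hne hij
    omega
  have hXs : X ⊆ Finset.Ico 0 ((5 : ℕ) : ℤ) := by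
    intro r hr
    obtain ⟨i, hi, rfl⟩ := Finset.mem_image.1 hr
    simp only [Finset.mem_Ico]
    norm_num
    omega
  have hX5 : X.card ≤ 5 := by simpa using Finset.card_le_card hXs
  have hW2 : W'.card ≤ 2 * (5 - X.card) := by
    refine cls _ a 5 (by norm_num) X hXs 2 ?_ ?_
    · intro i hi hiX
      obtain ⟨j, hj, hij⟩ := Finset.mem_image.1 hiX
      simp only [hW', hCo, Finset.mem_filter] at hi hj
      have := hFp i hi.1 j hj.1 (by rintro rfl; exact hi.2 hj.2) (by norm_num at *; omega)
      omega
    · intro r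
      by_contra hlt
      push Not at hlt
      obtain ⟨x, hx, y, hy, z, hz, hxy, hxz, hyz⟩ := Finset.two_lt_card.1 hlt
      simp only [hW', Finset.mem_filter] at hx hy hz
      have hxr := hx.2
      have hyr := hy.2
      have hzr := hz.2
      norm_num at hxr hyr hzr
      have k1 := hFp x hx.1.1 y hy.1.1 hxy (by omega)
      have k2 := hFp x hx.1.1 z hz.1.1 hxz (by omega)
      have k3 := hFp y hy.1.1 z hz.1.1 hyz (by omega)
      omega
  -- the exceptional element
  have hE := h.one (I.filter fun i => 30 ∣ m i) (Finset.filter_subset _ _) 30 (by omega)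
    (fun i hi => (Finset.mem_filter.1 hi).2)
  have eG := Finset.card_filter_add_card_filter_not (s := G) (fun i => 30 ∣ m i)
  have eF2 := Finset.card_filter_add_card_filter_not (s := F) (fun i => 30 ∣ m i)
  have hEE : (G.filter fun i => 30 ∣ m i).card + (F.filter fun i => 30 ∣ m i).card ≤ 1 := by
    rw [← Finset.card_union_of_disjoint]
    · refine le_trans (Finset.card_le_card ?_) hE
      intro i hi
      simp only [Finset.mem_union, Finset.mem_filter] at hi ⊢
      rcases hi with hi | hi
      · exact ⟨hGI hi.1, hi.2⟩
      · exact ⟨hFI hi.1, hi.2⟩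
    · rw [Finset.disjoint_left]
      intro i hi hj
      simp only [hG, hF, Finset.mem_filter] at hi hj
      exact hj.1.2 hi.1.2
  set G' := G.filter fun i => ¬ 30 ∣ m i with hG'
  set F' := F.filter fun i => ¬ 30 ∣ m i with hF'
  have hG'I : G' ⊆ I := (Finset.filter_subset _ _).trans hGI
  have hr0 : ({a i0 % 3} : Finset ℤ) ⊆ Finset.Ico 0 ((3 : ℕ) : ℤ) := by
    intro r hr
    simp only [Finset.mem_singleton] at hr
    simp only [Finset.mem_Ico]
    norm_num
    omega
  by_cases hb' : ∃ b ∈ F, ¬ 3 ∣ m b ∧ 2 ∣ m b ∧ ¬ 4 ∣ m b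
  swap
  · -- case (b)
    push Not at hb'
    have hF'5 : F'.card ≤ 1 * (5 - (∅ : Finset ℤ).card) := by
      refine cls _ a 5 (by norm_num) ∅ (by simp) 1 (by simp) ?_
      intro r
      rw [Finset.card_le_one]
      intro i hi j hj
      by_contra hij
      simp only [Finset.mem_filter, hF'] at hi hj
      have k := hFp i hi.1.1 j hj.1.1 hij (by have := hi.2; have := hj.2; norm_num at *; omega)
      have i5 := hF5 i hi.1.1
      have j5 := hF5 j hj.1.1
      have i4 := hb' i hi.1.1 (by omega) k.1
      have j4 := hb' j hj.1.1 (by omega) k.2.1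
      exact h.no20 (hFI hi.1.1) (hFI hj.1.1) hij (by omega) (by omega)
    rw [Finset.card_empty] at hF'5
    rcases le_or_gt N 17 with hN17 | hN17
    · have hG8 : G'.card ≤ 4 * (3 - ({a i0 % 3} : Finset ℤ).card) := by
        refine cls _ a 3 (by norm_num) _ hr0 4 ?_ ?_
        · intro i hi
          simp only [hG', Finset.mem_filter] at hi
          simpa using (hG3 i hi.1).2
        · intro r
          refine h.row' _ ((Finset.filter_subset _ _).trans hG'I) 3 4 (by norm_num) (by omega) ?_ ?_ ?_
          · intro i hi
            simp only [hG', Finset.mem_filter] at hi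
            exact (hG3 i hi.1.1).1
          · intro i hi j hj
            rw [(Finset.mem_filter.1 hi).2, (Finset.mem_filter.1 hj).2]
          · intro i hi j hj hij
            simp only [hG', Finset.mem_filter] at hi hj
            by_contra hge
            have h1 := h.le i (hGI hi.1.1) j (hGI hj.1.1) hij
            have h3 := Nat.dvd_gcd (hG3 i hi.1.1).1 (hG3 j hj.1.1).1
            have h15 : Nat.gcd (m i) (m j) = 15 := by omega
            have hi5 : 15 ∣ m i := h15 ▸ Nat.gcd_dvd_left (m i) (m j)
            have hj5 : 15 ∣ m j := h15 ▸ Nat.gcd_dvd_right (m i) (m j)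
            exact h.no45 (hGI hi.1.1) (hGI hj.1.1) hij (hG5 i hi.1.1 (by omega) hi.1.2).1
              (hG5 j hj.1.1 (by omega) hj.1.2).1
      rw [Finset.card_singleton] at hG8
      omega
    · have hG12 := h.rowW G hGI 3 (by norm_num) _ hr0 (fun i hi => (hG3 i hi).1) (fun i hi => by
        simpa using (hG3 i hi).2)
      rw [Finset.card_singleton] at hG12
      omega
  · -- case (a)
    by_cases h10 : N ≤ 16 ∧ ∃ b ∈ I, m b = 10
    · obtain ⟨hN16, b, hbI, hbm⟩ := h10
      have hodd : ∀ i ∈ G', ¬ 2 ∣ m i → 45 ∣ m i := by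
        intro i hi h2
        simp only [hG', Finset.mem_filter] at hi
        refine (hG5 i hi.1 ?_ hi.2).1
        have hib : i ≠ b := by rintro rfl; omega
        obtain ⟨p, hp, h1, h3, _, h5⟩ := h.cp (hGI hi.1) hbI hib
        rw [hbm] at h3
        rcases h5 with rfl | rfl | rfl | rfl | rfl | rfl | rfl | rfl <;> omega
      have heven : ∀ i ∈ G', 2 ∣ m i → a i % 2 ≠ a b % 2 := by
        intro i hi h2
        simp only [hG', Finset.mem_filter] at hi
        have h3 := hG3 i hi.1
        have hib : i ≠ b := by rintro rfl; omega
        obtain ⟨q, hq, k1, k2, k3⟩ := h.sep (hGI hi.1) hbI hib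
        rw [hbm] at k2
        rcases hq with rfl | rfl | rfl | rfl | rfl | rfl | rfl | rfl | rfl | rfl | rfl | rfl <;>
          omega
      have eO := Finset.card_filter_add_card_filter_not (s := G') (fun i => 2 ∣ m i)
      have hO := h.one (G'.filter fun i => ¬ 2 ∣ m i) ((Finset.filter_subset _ _).trans hG'I) 45
        (by omega) (fun i hi => hodd i (Finset.mem_filter.1 hi).1 (Finset.mem_filter.1 hi).2)
      have hEv : (G'.filter fun i => 2 ∣ m i).card ≤ 2 * (3 - ({a i0 % 3} : Finset ℤ).card) := by
        refine cls _ a 3 (by norm_num) _ hr0 2 ?_ ?_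
        · intro i hi
          simp only [hG', Finset.mem_filter] at hi
          simpa using (hG3 i hi.1.1).2
        · intro r
          refine le_trans (h.row0 _ (((Finset.filter_subset _ _).trans
            (Finset.filter_subset _ _)).trans hG'I) 6 (by norm_num) ?_ ?_) (by omega : max 1 (N / 6) ≤ 2)
          · intro i hi
            simp only [hG', Finset.mem_filter] at hi
            have := hG3 i hi.1.1.1
            have := hi.1.2
            omega
          · intro i hi j hj
            simp only [Finset.mem_filter] at hi hj
            have k1 := heven i hi.1.1 hi.1.2
            have k2 := heven j hj.1.1 hj.1.2
            have k3 := hi.2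
            have k4 := hj.2
            norm_num at *
            omega
      rw [Finset.card_singleton] at hEv
      omega
    · obtain ⟨b, hbF, hb3, hb2, hb4⟩ := hb'
      have e42 := Finset.card_filter_add_card_filter_not (s := G') (fun i => 42 ∣ m i)
      have h42 := h.one (G'.filter fun i => 42 ∣ m i) ((Finset.filter_subset _ _).trans hG'I) 42
        (by omega) (fun i hi => (Finset.mem_filter.1 hi).2)
      set H := G'.filter fun i => ¬ 42 ∣ m i with hH
      have hHI : H ⊆ I := (Finset.filter_subset _ _).trans hG'I
      have hH3 : ∀ i ∈ H, 3 ∣ m i ∧ a i % 3 ≠ a i0 % 3 ∧ ¬ 30 ∣ m i ∧ ¬ 42 ∣ m i := by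
        intro i hi
        simp only [hH, hG', Finset.mem_filter] at hi
        have := hG3 i hi.1.1
        exact ⟨this.1, this.2, hi.1.2, hi.2⟩
      have hH5 : ∀ i ∈ H, 5 ∣ m i → 45 ∣ m i := by
        intro i hi h5
        simp only [hH, hG', Finset.mem_filter] at hi
        exact (hG5 i hi.1.1 h5 hi.1.2).1
      have heven : ∀ i ∈ H, 2 ∣ m i → a i % 2 ≠ a b % 2 := by
        intro i hi h2
        have h3 := hH3 i hi
        have hib : i ≠ b := by rintro rfl; exact hb3 h3.1
        obtain ⟨q, hq, k1, k2, k3, k4⟩ := h.sepn (hHI hi) (hFI hbF) hib 2 h2 hb2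
        rcases hq with rfl | rfl | rfl | rfl | rfl | rfl | rfl | rfl | rfl | rfl | rfl | rfl <;>
          norm_num [Nat.lcm] at k1 k2 k3 k4 <;> omega
      have hH6 : H.card ≤ 3 * (3 - ({a i0 % 3} : Finset ℤ).card) := by
        refine cls _ a 3 (by norm_num) _ hr0 3 ?_ ?_
        · intro i hi
          simpa using (hH3 i hi).2.1
        · intro r
          set K := H.filter fun i => a i % ((3 : ℕ) : ℤ) = r with hK
          have hKH : K ⊆ H := Finset.filter_subset _ _
          have hKr : ∀ i ∈ K, a i % 3 = r := fun i hi => by simpa using (Finset.mem_filter.1 hi).2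
          by_cases ho : ∃ o ∈ K, ¬ 2 ∣ m o
          · obtain ⟨o, hoK, ho2⟩ := ho
            have k9 : ∀ i ∈ K, 9 ∣ m i ∨ K ⊆ {o} := by
              by_cases hs : K ⊆ {o}
              · exact fun _ _ => Or.inr hs
              have kk : ∀ i ∈ K, i ≠ o → 9 ∣ m i ∧ 9 ∣ m o := by
                intro i hi hio
                have h3 := hH3 i (hKH hi)
                have ho3 := hH3 o (hKH hoK)
                have hr1 := hKr i hi
                have hr2 := hKr o hoK
                have k5 := hH5 i (hKH hi)
                have ko5 := hH5 o (hKH hoK)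
                have n45 := h.no45 (hHI (hKH hi)) (hHI (hKH hoK)) hio
                obtain ⟨q, hq, k1, k2, k3, k4⟩ :=
                  h.sepn (hHI (hKH hi)) (hHI (hKH hoK)) hio 3 h3.1 ho3.1
                rcases hq with rfl | rfl | rfl | rfl | rfl | rfl | rfl | rfl | rfl | rfl | rfl | rfl
                case inr.inr.inr.inr.inr.inr.inl => exact (n45 (k5 k1) (ko5 k2)).elim
                all_goals norm_num [Nat.lcm] at k1 k2 k3 k4
                all_goals omega
              obtain ⟨x, hx, hxo⟩ : ∃ x ∈ K, x ≠ o := by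
                by_contra hcon
                push Not at hcon
                exact hs fun i hi => by simpa using hcon i hi
              intro i hi
              left
              by_cases hio : i = o
              · rw [hio]; exact (kk x hx hxo).2
              · exact (kk i hi hio).1
            by_cases hs : K ⊆ {o}
            · have := Finset.card_le_card hs
              simp at this
              omega
            refine card3 K a (fun i hi j hj => by rw [hKr i hi, hKr j hj]) ?_
            intro i hi j hj hij h9
            have i9 := (k9 i hi).resolve_right hs
            have j9 := (k9 j hj).resolve_right hs
            have ie := heven i (hKH hi)
            have je := heven j (hKH hj)
            obtain ⟨q, hq, k1, k2, k3, k4⟩ :=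
              h.sepn (hHI (hKH hi)) (hHI (hKH hj)) hij 9 i9 j9
            rcases hq with rfl | rfl | rfl | rfl | rfl | rfl | rfl | rfl | rfl | rfl | rfl | rfl <;>
              norm_num [Nat.lcm] at k1 k2 k3 k4 <;> omega
          · push Not at ho
            refine le_trans (h.row0 K (hKH.trans hHI) 6 (by norm_num) ?_ ?_)
              (by omega : max 1 (N / 6) ≤ 3)
            · intro i hi
              have := (hH3 i (hKH hi)).1
              have := ho i hi
              omega
            · intro i hi j hj
              have k1 := heven i (hKH hi) (ho i hi)
              have k2 := heven j (hKH hj) (ho j hj)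
              have k3 := hKr i hi
              have k4 := hKr j hj
              norm_num
              omega
      rw [Finset.card_singleton] at hH6
      rcases le_or_gt N 16 with hN16 | hN16
      · have hno : ∀ i ∈ I, m i ≠ 10 := fun i hi h1 => h10 ⟨hN16, i, hi, h1⟩
        have e3 := Finset.card_filter_add_card_filter_not (s := W') (fun i => 3 ∣ m i)
        have hw := h.w5 hno (W'.filter fun i => ¬ 3 ∣ m i)
          (((Finset.filter_subset _ _).trans (Finset.filter_subset _ _)).trans hFI) (fun i hi => by
            simp only [hW', Finset.mem_filter] at hi
            exact ⟨hF5 i hi.1.1, hi.2⟩)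
        have hbp : (bp N).card ≤ 3 := by interval_cases N <;> decide
        have hw3 : (W'.filter fun i => 3 ∣ m i).card ≤ (F.filter fun i => 30 ∣ m i).card := by
          refine Finset.card_le_card ?_
          intro i hi
          simp only [hW', Finset.mem_filter] at hi ⊢
          have := hF5 i hi.1.1
          exact ⟨hi.1.1, by omega⟩
        omega
      · omega

theorem P15 (h : Ctx I a m N) (hN : 15 ≤ N) (i0 : ι) (hi0 : i0 ∈ I) (hm0 : m i0 = 15) :
    False := by
  by_cases hcn : ∃ c ∈ I, 3 ∣ m c ∧ 5 ∣ m c ∧ ¬ 2 ∣ m c ∧ ¬ 9 ∣ m c ∧ a c % 3 ≠ a i0 % 3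
  · obtain ⟨c, hc, c3, c5, c2, c9, hne⟩ := hcn
    exact h.P15a hN i0 hi0 hm0 c hc c3 c5 c2 c9 hne
  · refine h.P15b hN i0 hi0 hm0 ?_
    intro c hc c3 c5 c2 c9
    by_contra hne
    exact hcn ⟨c, hc, c3, c5, c2, c9, hne⟩
end Ctx
end DC

namespace DC

/-! ### Part 5: representatives 6, 12, 18 -/

structure C23 {ι : Type} (I : Finset ι) (a : ι → ℤ) (m : ι → ℕ) (N : ℕ) : Prop
    extends Ctx I a m N where
  n23 : ∀ i ∈ I, 2 ∣ m i ∨ 3 ∣ m i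
  n10 : 10 ≤ N → ∀ i ∈ I, m i ≠ 10
  n14 : 14 ≤ N → ∀ i ∈ I, m i ≠ 14
  n15 : 15 ≤ N → ∀ i ∈ I, m i ≠ 15
  N6 : 6 ≤ N

def YY {ι : Type} (I : Finset ι) (m : ι → ℕ) : Finset ι := I.filter fun i => ¬ 2 ∣ m i
def ZZ {ι : Type} (I : Finset ι) (m : ι → ℕ) : Finset ι := I.filter fun i => ¬ 3 ∣ m i
def EE {ι : Type} (I : Finset ι) (m : ι → ℕ) (N : ℕ) : Finset ι :=
  I.filter fun i => 2 ∣ m i ∧ 3 ∣ m i ∧ ((10 ≤ N ∧ 5 ∣ m i) ∨ (14 ≤ N ∧ 7 ∣ m i))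
def TT {ι : Type} (I : Finset ι) (m : ι → ℕ) (N : ℕ) : Finset ι :=
  I.filter fun i => 2 ∣ m i ∧ 3 ∣ m i ∧ ¬ ((10 ≤ N ∧ 5 ∣ m i) ∨ (14 ≤ N ∧ 7 ∣ m i))

namespace C23
variable {ι : Type} {I : Finset ι} {a : ι → ℤ} {m : ι → ℕ} {N : ℕ}

theorem total (h : C23 I a m N) :
    I.card = (YY I m).card + (ZZ I m).card + (EE I m N).card + (TT I m N).card := by
  classical
  have e1 := Finset.card_filter_add_card_filter_not (s := I) (fun i => ¬ 2 ∣ m i)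
  have e2 := Finset.card_filter_add_card_filter_not (s := I.filter fun i => ¬ ¬ 2 ∣ m i)
    (fun i => ¬ 3 ∣ m i)
  have e3 := Finset.card_filter_add_card_filter_not
    (s := (I.filter fun i => ¬ ¬ 2 ∣ m i).filter fun i => ¬ ¬ 3 ∣ m i)
    (fun i => (10 ≤ N ∧ 5 ∣ m i) ∨ (14 ≤ N ∧ 7 ∣ m i))
  have hz : (I.filter fun i => ¬ ¬ 2 ∣ m i).filter (fun i => ¬ 3 ∣ m i) = ZZ I m := by
    ext i
    simp only [ZZ, Finset.mem_filter]
    have := h.n23 i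
    tauto
  have he : ((I.filter fun i => ¬ ¬ 2 ∣ m i).filter fun i => ¬ ¬ 3 ∣ m i).filter
      (fun i => (10 ≤ N ∧ 5 ∣ m i) ∨ (14 ≤ N ∧ 7 ∣ m i)) = EE I m N := by
    ext i
    simp only [EE, Finset.mem_filter]
    tauto
  have ht : ((I.filter fun i => ¬ ¬ 2 ∣ m i).filter fun i => ¬ ¬ 3 ∣ m i).filter
      (fun i => ¬ ((10 ≤ N ∧ 5 ∣ m i) ∨ (14 ≤ N ∧ 7 ∣ m i))) = TT I m N := by
    ext i
    simp only [TT, Finset.mem_filter]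
    tauto
  rw [hz] at e2
  rw [he, ht] at e3
  have : (I.filter fun i => ¬ 2 ∣ m i) = YY I m := rfl
  rw [this] at e1
  omega

theorem hY (h : C23 I a m N) {y : ι} (hy : y ∈ YY I m) : y ∈ I ∧ ¬ 2 ∣ m y ∧ 3 ∣ m y := by
  have := Finset.mem_filter.1 hy
  have := h.n23 y this.1
  tauto
theorem hZ (h : C23 I a m N) {z : ι} (hz : z ∈ ZZ I m) : z ∈ I ∧ 2 ∣ m z ∧ ¬ 3 ∣ m z := by
  have := Finset.mem_filter.1 hz
  have := h.n23 z this.1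
  tauto
theorem YI : YY I m ⊆ I := Finset.filter_subset _ _
theorem ZI : ZZ I m ⊆ I := Finset.filter_subset _ _
theorem TI : TT I m N ⊆ I := Finset.filter_subset _ _
theorem hT {x : ι} (hx : x ∈ TT I m N) : x ∈ I ∧ 6 ∣ m x ∧
    ¬ ((10 ≤ N ∧ 5 ∣ m x) ∨ (14 ≤ N ∧ 7 ∣ m x)) := by
  have := Finset.mem_filter.1 hx
  exact ⟨this.1, by omega, this.2.2.2⟩

theorem neY (h : C23 I a m N) : (YY I m).Nonempty := by
  obtain ⟨i, hi, h2⟩ := h.ex 2 le_rfl h.two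
  exact ⟨i, Finset.mem_filter.2 ⟨hi, h2⟩⟩
theorem neZ (h : C23 I a m N) : (ZZ I m).Nonempty := by
  have := h.N6
  obtain ⟨i, hi, h2⟩ := h.ex 3 (by norm_num) (by omega)
  exact ⟨i, Finset.mem_filter.2 ⟨hi, h2⟩⟩

theorem xy (h : C23 I a m N) {x y : ι} (hx : x ∈ TT I m N) (hy : y ∈ YY I m) :
    a x % 3 ≠ a y % 3 ∨ (9 ∣ m x ∧ 9 ∣ m y ∧ a x % 9 ≠ a y % 9) := by
  have hN := h.N19
  obtain ⟨xI, x6, x57⟩ := hT hx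
  obtain ⟨yI, y2, y3⟩ := h.hY hy
  have hne : x ≠ y := by rintro rfl; omega
  obtain ⟨q, hq, k1, k2, k3, k4⟩ := h.sepn xI yI hne 3 (by omega) y3
  rcases hq with rfl | rfl | rfl | rfl | rfl | rfl | rfl | rfl | rfl | rfl | rfl | rfl <;>
    norm_num [Nat.lcm] at k1 k2 k3 k4 <;> omega

theorem xz (h : C23 I a m N) {x z : ι} (hx : x ∈ TT I m N) (hz : z ∈ ZZ I m) :
    a x % 2 ≠ a z % 2 ∨ (4 ∣ m x ∧ 4 ∣ m z ∧ a x % 4 ≠ a z % 4) ∨ (8 ∣ m x ∧ 8 ∣ m z) := by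
  have hN := h.N19
  obtain ⟨xI, x6, x57⟩ := hT hx
  obtain ⟨zI, z2, z3⟩ := h.hZ hz
  have hne : x ≠ z := by rintro rfl; omega
  obtain ⟨q, hq, k1, k2, k3, k4⟩ := h.sepn xI zI hne 2 (by omega) z2
  rcases hq with rfl | rfl | rfl | rfl | rfl | rfl | rfl | rfl | rfl | rfl | rfl | rfl <;>
    norm_num [Nat.lcm] at k1 k2 k3 k4 <;> omega

/-- elements in one class mod 2 -/
theorem L6 (h : C23 I a m N) (J : Finset ι) (hJ : J ⊆ TT I m N) (W : Finset ℤ)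
    (hW : W ⊆ Finset.Ico 0 ((3 : ℕ) : ℤ)) (h2 : ∀ i ∈ J, ∀ j ∈ J, a i % 2 = a j % 2)
    (h3 : ∀ i ∈ J, a i % 3 ∉ W) : J.card ≤ N / 6 * (3 - W.card) := by
  have h6 := h.N6
  refine cls _ a 3 (by norm_num) W hW _ (fun i hi => by simpa using h3 i hi) ?_
  intro r
  refine le_trans (h.row0 _ (((Finset.filter_subset _ _).trans hJ).trans TI) 6 (by norm_num) ?_ ?_)
    (by omega : max 1 (N / 6) ≤ N / 6)
  · intro i hi
    exact (hT (hJ (Finset.mem_filter.1 hi).1)).2.1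
  · intro i hi j hj
    simp only [Finset.mem_filter] at hi hj
    have k1 := h2 i hi.1 j hj.1
    have k3 := hi.2
    have k4 := hj.2
    norm_num at *
    omega

/-- elements in one class mod 2 and congruent to y mod 3 -/
theorem d18 (h : C23 I a m N) {x y : ι} (hx : x ∈ TT I m N) (hy : y ∈ YY I m)
    (h3 : a x % 3 = a y % 3) : 18 ∣ m x ∧ 9 ∣ m y ∧ a x % 9 ≠ a y % 9 := by
  have := h.xy hx hy
  have := hT hx
  omega

theorem L18 (h : C23 I a m N) (J : Finset ι) (hJ : J ⊆ TT I m N) (y : ι) (hy : y ∈ YY I m)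
    (h2 : ∀ i ∈ J, ∀ j ∈ J, a i % 2 = a j % 2) (h3 : ∀ i ∈ J, a i % 3 = a y % 3) :
    J.card ≤ 2 := by
  have hN := h.N19
  by_contra hlt
  push Not at hlt
  obtain ⟨u, hu, v, hv, w, hw, huv, huw, hvw⟩ := Finset.two_lt_card.1 hlt
  have key : ∀ i ∈ J, ∀ j ∈ J, i ≠ j → a i % 9 ≠ a j % 9 := by
    intro i hi j hj hij h9
    have k1 := h.d18 (hJ hi) hy (h3 i hi)
    have k2 := h.d18 (hJ hj) hy (h3 j hj)
    have k3 := h2 i hi j hj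
    obtain ⟨q, hq, e1, e2, e3, e4⟩ := h.sepn (TI (hJ hi)) (TI (hJ hj)) hij 18 k1.1 k2.1
    rcases hq with rfl | rfl | rfl | rfl | rfl | rfl | rfl | rfl | rfl | rfl | rfl | rfl <;>
      norm_num [Nat.lcm] at e1 e2 e3 e4 <;> omega
  have := key u hu v hv huv
  have := key u hu w hw huw
  have := key v hv w hw hvw
  have := h.d18 (hJ hu) hy (h3 u hu)
  have := h.d18 (hJ hv) hy (h3 v hv)
  have := h.d18 (hJ hw) hy (h3 w hw)
  have := h3 u hu
  have := h3 v hv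
  have := h3 w hw
  omega

theorem d12 (h : C23 I a m N) {x z : ι} (hx : x ∈ TT I m N) (hz : z ∈ ZZ I m)
    (h3 : a x % 2 = a z % 2) : 12 ∣ m x ∧ 4 ∣ m z ∧ (a x % 4 = a z % 4 → 24 ∣ m x) := by
  have := h.xz hx hz
  have := hT hx
  omega

theorem L12 (h : C23 I a m N) (J : Finset ι) (hJ : J ⊆ TT I m N) (W : Finset ℤ)
    (hW : W ⊆ Finset.Ico 0 ((3 : ℕ) : ℤ)) (h12 : ∀ i ∈ J, 12 ∣ m i)
    (h4 : ∀ i ∈ J, ∀ j ∈ J, a i % 4 = a j % 4)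
    (h3 : ∀ i ∈ J, a i % 3 ∉ W) : J.card ≤ 3 - W.card := by
  have hN := h.N19
  rw [← one_mul (3 - W.card)]
  refine cls _ a 3 (by norm_num) W hW _ (fun i hi => by simpa using h3 i hi) ?_
  intro r
  rw [Finset.card_le_one]
  intro i hi j hj
  by_contra hij
  simp only [Finset.mem_filter] at hi hj
  have k1 := h12 i hi.1
  have k2 := h12 j hj.1
  have k3 := h4 i hi.1 j hj.1
  have k4 := hi.2
  have k5 := hj.2
  obtain ⟨q, hq, e1, e2, e3, e4⟩ := h.sepn (TI (hJ hi.1)) (TI (hJ hj.1)) hij 12 k1 k2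
  rcases hq with rfl | rfl | rfl | rfl | rfl | rfl | rfl | rfl | rfl | rfl | rfl | rfl <;>
    norm_num [Nat.lcm] at e1 e2 e3 e4 k4 k5 <;> omega

theorem sing3 (x : ℤ) : ({x % 3} : Finset ℤ) ⊆ Finset.Ico 0 ((3 : ℕ) : ℤ) := by
  intro r hr
  simp only [Finset.mem_singleton] at hr
  simp only [Finset.mem_Ico]
  norm_num
  omega

/-- elements congruent to z mod 2, not congruent to y mod 3 -/
theorem L3 (h : C23 I a m N) (J : Finset ι) (hJ : J ⊆ TT I m N) (W : Finset ℤ)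
    (hW : W ⊆ Finset.Ico 0 ((3 : ℕ) : ℤ)) (z : ι) (hz : z ∈ ZZ I m)
    (h2 : ∀ i ∈ J, a i % 2 = a z % 2)
    (h3 : ∀ i ∈ J, a i % 3 ∉ W) : J.card ≤ (3 - W.card) + 1 := by
  classical
  have hN := h.N19
  have e := Finset.card_filter_add_card_filter_not (s := J) (fun i => a i % 4 = a z % 4)
  have e1 := h.one (J.filter fun i => a i % 4 = a z % 4)
    (((Finset.filter_subset _ _).trans hJ).trans TI) 24 (by omega) (by
      intro i hi
      obtain ⟨hi, hi4⟩ := Finset.mem_filter.1 hi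
      exact (h.d12 (hJ hi) hz (h2 i hi)).2.2 hi4)
  have e2 := h.L12 (J.filter fun i => ¬ a i % 4 = a z % 4) ((Finset.filter_subset _ _).trans hJ)
    W hW (fun i hi => (h.d12 (hJ (Finset.mem_filter.1 hi).1) hz (h2 i (Finset.mem_filter.1 hi).1)).1)
    (by
      intro i hi j hj
      simp only [Finset.mem_filter] at hi hj
      have := h2 i hi.1
      have := h2 j hj.1
      omega) (fun i hi => h3 i (Finset.mem_filter.1 hi).1)
  omega

def T1 (I : Finset ι) (a : ι → ℤ) (m : ι → ℕ) (N : ℕ) (y z : ι) : Finset ι :=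
  (TT I m N).filter fun i => ¬ a i % 2 = a z % 2 ∧ ¬ a i % 3 = a y % 3
def T2 (I : Finset ι) (a : ι → ℤ) (m : ι → ℕ) (N : ℕ) (y z : ι) : Finset ι :=
  (TT I m N).filter fun i => ¬ a i % 2 = a z % 2 ∧ a i % 3 = a y % 3
def T3 (I : Finset ι) (a : ι → ℤ) (m : ι → ℕ) (N : ℕ) (y z : ι) : Finset ι :=
  (TT I m N).filter fun i => a i % 2 = a z % 2 ∧ ¬ a i % 3 = a y % 3
def T4 (I : Finset ι) (a : ι → ℤ) (m : ι → ℕ) (N : ℕ) (y z : ι) : Finset ι :=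
  (TT I m N).filter fun i => a i % 2 = a z % 2 ∧ a i % 3 = a y % 3

theorem Tsum (y z : ι) : (TT I m N).card = (T1 I a m N y z).card + (T2 I a m N y z).card +
    (T3 I a m N y z).card + (T4 I a m N y z).card := by
  classical
  have e := Finset.card_filter_add_card_filter_not (s := TT I m N) (fun i => a i % 2 = a z % 2)
  have e1 := Finset.card_filter_add_card_filter_not
    (s := (TT I m N).filter fun i => a i % 2 = a z % 2) (fun i => a i % 3 = a y % 3)
  have e2 := Finset.card_filter_add_card_filter_not
    (s := (TT I m N).filter fun i => ¬ a i % 2 = a z % 2) (fun i => a i % 3 = a y % 3)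
  simp only [Finset.filter_filter] at e1 e2
  simp only [T1, T2, T3, T4]
  omega

theorem card_add_one (h : C23 I a m N) (A B : Finset ι) (hA : A ⊆ TT I m N) (hB : B ⊆ TT I m N)
    (hAB : Disjoint A B) (d : ℕ) (hd : N < d) (h1 : ∀ i ∈ A, d ∣ m i) (h2 : ∀ i ∈ B, d ∣ m i) :
    A.card + B.card ≤ 1 := by
  classical
  rw [← Finset.card_union_of_disjoint hAB]
  refine h.one _ (Finset.union_subset (hA.trans TI) (hB.trans TI)) d hd ?_
  intro i hi
  rcases Finset.mem_union.1 hi with hi | hi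
  · exact h1 i hi
  · exact h2 i hi

theorem caps (h : C23 I a m N) (y z : ι) (hy : y ∈ YY I m) (hz : z ∈ ZZ I m) :
    (T1 I a m N y z).card ≤ N / 6 * 2 ∧ (T2 I a m N y z).card ≤ 2 ∧
    (N < 18 → (T2 I a m N y z).card + (T4 I a m N y z).card ≤ 1) ∧
    (T3 I a m N y z).card ≤ 3 ∧
    (N < 12 → (T3 I a m N y z).card + (T4 I a m N y z).card ≤ 1) ∧
    (T4 I a m N y z).card ≤ 1 ∧
    (¬ 9 ∣ m y → (T2 I a m N y z).card = 0 ∧ (T4 I a m N y z).card = 0) ∧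
    (¬ 4 ∣ m z → (T3 I a m N y z).card = 0 ∧ (T4 I a m N y z).card = 0) := by
  classical
  have hN := h.N19
  have s1 : T1 I a m N y z ⊆ TT I m N := Finset.filter_subset _ _
  have s2 : T2 I a m N y z ⊆ TT I m N := Finset.filter_subset _ _
  have s3 : T3 I a m N y z ⊆ TT I m N := Finset.filter_subset _ _
  have s4 : T4 I a m N y z ⊆ TT I m N := Finset.filter_subset _ _
  have p1 : ∀ i ∈ T1 I a m N y z, ¬ a i % 2 = a z % 2 ∧ ¬ a i % 3 = a y % 3 :=
    fun i hi => (Finset.mem_filter.1 hi).2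
  have p2 : ∀ i ∈ T2 I a m N y z, ¬ a i % 2 = a z % 2 ∧ a i % 3 = a y % 3 :=
    fun i hi => (Finset.mem_filter.1 hi).2
  have p3 : ∀ i ∈ T3 I a m N y z, a i % 2 = a z % 2 ∧ ¬ a i % 3 = a y % 3 :=
    fun i hi => (Finset.mem_filter.1 hi).2
  have p4 : ∀ i ∈ T4 I a m N y z, a i % 2 = a z % 2 ∧ a i % 3 = a y % 3 :=
    fun i hi => (Finset.mem_filter.1 hi).2
  refine ⟨?_, ?_, ?_, ?_, ?_, ?_, ?_, ?_⟩
  · have := h.L6 _ s1 _ (sing3 (a y)) (fun i hi j hj => by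
      have := p1 i hi; have := p1 j hj; omega) (fun i hi => by simpa using (p1 i hi).2)
    simpa using this
  · exact h.L18 _ s2 y hy (fun i hi j hj => by
      have := p2 i hi; have := p2 j hj; omega) (fun i hi => (p2 i hi).2)
  · intro hN18
    refine h.card_add_one _ _ s2 s4 ?_ 18 hN18 ?_ ?_
    · rw [Finset.disjoint_left]
      intro i hi hj
      exact (p2 i hi).1 (p4 i hj).1
    · exact fun i hi => (h.d18 (s2 hi) hy (p2 i hi).2).1
    · exact fun i hi => (h.d18 (s4 hi) hy (p4 i hi).2).1
  · have := h.L3 _ s3 _ (sing3 (a y)) z hz (fun i hi => (p3 i hi).1)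
      (fun i hi => by simpa using (p3 i hi).2)
    simpa using this
  · intro hN18
    refine h.card_add_one _ _ s3 s4 ?_ 12 hN18 ?_ ?_
    · rw [Finset.disjoint_left]
      intro i hi hj
      exact (p3 i hi).2 (p4 i hj).2
    · exact fun i hi => (h.d12 (s3 hi) hz (p3 i hi).1).1
    · exact fun i hi => (h.d12 (s4 hi) hz (p4 i hi).1).1
  · refine h.one _ (s4.trans TI) 36 (by omega) ?_
    intro i hi
    have := (h.d12 (s4 hi) hz (p4 i hi).1).1
    have := (h.d18 (s4 hi) hy (p4 i hi).2).1
    omega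
  · intro h9
    constructor
    · rw [Finset.card_eq_zero, Finset.eq_empty_iff_forall_notMem]
      exact fun i hi => h9 (h.d18 (s2 hi) hy (p2 i hi).2).2.1
    · rw [Finset.card_eq_zero, Finset.eq_empty_iff_forall_notMem]
      exact fun i hi => h9 (h.d18 (s4 hi) hy (p4 i hi).2).2.1
  · intro h9
    constructor
    · rw [Finset.card_eq_zero, Finset.eq_empty_iff_forall_notMem]
      exact fun i hi => h9 (h.d12 (s3 hi) hz (p3 i hi).1).2.1
    · rw [Finset.card_eq_zero, Finset.eq_empty_iff_forall_notMem]
      exact fun i hi => h9 (h.d12 (s4 hi) hz (p4 i hi).1).2.1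

theorem Ecard (h : C23 I a m N) : (EE I m N).card ≤ 2 ∧ (N < 14 → (EE I m N).card ≤ 1) ∧
    (N < 10 → (EE I m N).card = 0) := by
  classical
  have hN := h.N19
  have e := Finset.card_filter_add_card_filter_not (s := EE I m N) (fun i => 10 ≤ N ∧ 5 ∣ m i)
  have hEI : EE I m N ⊆ I := Finset.filter_subset _ _
  have e1 := h.one ((EE I m N).filter fun i => 10 ≤ N ∧ 5 ∣ m i)
    ((Finset.filter_subset _ _).trans hEI) 30 (by omega) (by
      intro i hi
      simp only [EE, Finset.mem_filter] at hi
      omega)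
  have e2 := h.one ((EE I m N).filter fun i => ¬ (10 ≤ N ∧ 5 ∣ m i))
    ((Finset.filter_subset _ _).trans hEI) 42 (by omega) (by
      intro i hi
      simp only [EE, Finset.mem_filter] at hi
      omega)
  refine ⟨by omega, ?_, ?_⟩
  · intro h14
    have : ((EE I m N).filter fun i => ¬ (10 ≤ N ∧ 5 ∣ m i)).card = 0 := by
      rw [Finset.card_eq_zero, Finset.eq_empty_iff_forall_notMem]
      intro i hi
      simp only [EE, Finset.mem_filter] at hi
      omega
    omega
  · intro h10
    rw [Finset.card_eq_zero, Finset.eq_empty_iff_forall_notMem]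
    intro i hi
    simp only [EE, Finset.mem_filter] at hi
    omega

end C23
end DC

namespace DC

/-! ### Part 6: counting for representatives 6, 12, 18 -/

theorem pair {ι : Type} (Y Z : Finset ι) (m : ι → ℕ) (S : Finset ℕ)
    (h1 : ∀ y ∈ Y, ∀ z ∈ Z, ∃ p ∈ S, p ∣ m y ∧ p ∣ m z)
    (h2 : ∀ y ∈ Y, ∀ z ∈ Y, y ≠ z → ∀ p ∈ S, p ∣ m y → p ∣ m z → False)
    (h3 : ∀ y ∈ Z, ∀ z ∈ Z, y ≠ z → ∀ p ∈ S, p ∣ m y → p ∣ m z → False) :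
    Y.card * Z.card ≤ S.card := by
  classical
  choose! f hf hfy hfz using h1
  rw [← Finset.card_product]
  refine Finset.card_le_card_of_injOn (fun x => f x.1 x.2) ?_ ?_
  · intro x hx
    have hx := Finset.mem_product.1 (Finset.mem_coe.1 hx)
    exact hf _ hx.1 _ hx.2
  · intro x hx x' hx' hxx
    have hx := Finset.mem_product.1 (Finset.mem_coe.1 hx)
    have hx' := Finset.mem_product.1 (Finset.mem_coe.1 hx')
    have hxx : f x.1 x.2 = f x'.1 x'.2 := hxx
    have k1 := hf _ hx.1 _ hx.2
    have k2 := hfy _ hx.1 _ hx.2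
    have k3 := hfz _ hx.1 _ hx.2
    have k4 := hfy _ hx'.1 _ hx'.2
    have k5 := hfz _ hx'.1 _ hx'.2
    rw [← hxx] at k4 k5
    refine Prod.ext ?_ ?_
    · by_contra hne
      exact h2 _ hx.1 _ hx'.1 hne _ k1 k2 k4
    · by_contra hne
      exact h3 _ hx.2 _ hx'.2 hne _ k1 k3 k5

theorem mul_le_add (e f r : ℕ) (he : 1 ≤ e) (hf : 1 ≤ f) (h : e * f ≤ r) : e + f ≤ r + 1 := by
  obtain ⟨e, rfl⟩ := Nat.exists_eq_add_of_le' he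
  obtain ⟨f, rfl⟩ := Nat.exists_eq_add_of_le' hf
  nlinarith [Nat.zero_le (e * f)]

namespace C23
open Ctx
variable {ι : Type} {I : Finset ι} {a : ι → ℤ} {m : ι → ℕ} {N : ℕ}

theorem bp_mem {p : ℕ} (hp : p ∈ bp N) : (p = 7 ∨ p = 11 ∨ p = 13 ∨ p = 17 ∨ p = 19) ∧ p ≤ N := by
  simpa [bp] using hp

theorem mem_bp {p : ℕ} (hp : p = 7 ∨ p = 11 ∨ p = 13 ∨ p = 17 ∨ p = 19) (hN : p ≤ N) :
    p ∈ bp N := by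
  simp only [bp, Finset.mem_filter, Finset.mem_insert, Finset.mem_singleton]
  exact ⟨hp, hN⟩

theorem cyz (h : C23 I a m N) {y z : ι} (hy : y ∈ YY I m) (hz : z ∈ ZZ I m) :
    ∃ p, (p = 5 ∨ p ∈ bp N) ∧ p ∣ m y ∧ p ∣ m z := by
  have hy := h.hY hy
  have hz := h.hZ hz
  obtain ⟨p, hp, k1, k2, k3, k4⟩ := h.cp hy.1 hz.1 (by rintro rfl; tauto)
  refine ⟨p, ?_, k1, k2⟩
  have n2 : p ≠ 2 := by rintro rfl; exact hy.2.1 k1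
  have n3 : p ≠ 3 := by rintro rfl; exact hz.2.2 k2
  by_cases h5 : p = 5
  · exact Or.inl h5
  · exact Or.inr (mem_bp (by tauto) k3)

theorem ydis (h : C23 I a m N) {y z : ι} (hy : y ∈ YY I m) (hz : z ∈ YY I m) (hne : y ≠ z)
    {p : ℕ} (hp : p ∈ bp N) (h1 : p ∣ m y) (h2 : p ∣ m z) : False := by
  have hN := h.N19
  have hy := h.hY hy
  have hz := h.hY hz
  have hp := bp_mem hp
  have := h.dle2 hy.1 hz.1 hne 3 p (by
    rcases hp with ⟨rfl | rfl | rfl | rfl | rfl, _⟩ <;> norm_num) hy.2.2 hz.2.2 h1 h2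
  omega

theorem y5 (h : C23 I a m N) {y z : ι} (hy : y ∈ YY I m) (hz : z ∈ YY I m) (hne : y ≠ z)
    (h1 : 5 ∣ m y) (h2 : 5 ∣ m z) : 15 ≤ N ∧ ¬ (9 ∣ m y ∧ 9 ∣ m z) := by
  have hN := h.N19
  have hy := h.hY hy
  have hz := h.hY hz
  refine ⟨h.dle hy.1 hz.1 hne 15 (by omega) (by omega), ?_⟩
  intro hh
  have := h.dle hy.1 hz.1 hne 45 (by omega) (by omega)
  omega

theorem zdis (h : C23 I a m N) {y z : ι} (hy : y ∈ ZZ I m) (hz : z ∈ ZZ I m) (hne : y ≠ z)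
    {p : ℕ} (hp : p ∈ bp N) (h1 : p ∣ m y) (h2 : p ∣ m z) :
    p = 7 ∧ 14 ≤ N ∧ ¬ (4 ∣ m y ∧ 4 ∣ m z) := by
  have hN := h.N19
  have hy := h.hZ hy
  have hz := h.hZ hz
  have hp := bp_mem hp
  have := h.dle2 hy.1 hz.1 hne 2 p (by
    rcases hp with ⟨rfl | rfl | rfl | rfl | rfl, _⟩ <;> norm_num) hy.2.1 hz.2.1 h1 h2
  have p7 : p = 7 := by omega
  subst p7
  refine ⟨rfl, by omega, ?_⟩
  intro hh
  have := h.dle hy.1 hz.1 hne 28 (by omega) (by omega)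
  omega

theorem z5 (h : C23 I a m N) {y z : ι} (hy : y ∈ ZZ I m) (hz : z ∈ ZZ I m) (hne : y ≠ z)
    (h1 : 5 ∣ m y) (h2 : 5 ∣ m z) : 10 ≤ N ∧ ¬ (4 ∣ m y ∧ 4 ∣ m z) := by
  have hN := h.N19
  have hy := h.hZ hy
  have hz := h.hZ hz
  refine ⟨h.dle hy.1 hz.1 hne 10 (by omega) (by omega), ?_⟩
  intro hh
  have := h.dle hy.1 hz.1 hne 20 (by omega) (by omega)
  omega

theorem bp5 : 5 ∉ bp N := fun h => by have := bp_mem h; omega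

/-- the product bound -/
theorem ef (h : C23 I a m N) (dY : N < 15 ∨ ∀ y ∈ YY I m, 9 ∣ m y)
    (dZ : N < 10 ∨ ∀ z ∈ ZZ I m, 4 ∣ m z) (S : Finset ℕ) (hS : S ⊆ insert 5 (bp N))
    (hc : ∀ y ∈ YY I m, ∀ p, p ∈ insert 5 (bp N) → p ∣ m y → p ∈ S) :
    (YY I m).card * (ZZ I m).card ≤ S.card := by
  refine pair _ _ m S ?_ ?_ ?_
  · intro y hy z hz
    obtain ⟨p, hp, k1, k2⟩ := h.cyz hy hz
    exact ⟨p, hc y hy p (by simpa using hp) k1, k1, k2⟩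
  · intro y hy z hz hne p hp h1 h2
    rcases Finset.mem_insert.1 (hS hp) with rfl | hp
    · have := h.y5 hy hz hne h1 h2
      rcases dY with k | k
      · omega
      · exact this.2 ⟨k y hy, k z hz⟩
    · exact h.ydis hy hz hne hp h1 h2
  · intro y hy z hz hne p hp h1 h2
    rcases Finset.mem_insert.1 (hS hp) with rfl | hp
    · have := h.z5 hy hz hne h1 h2
      rcases dZ with k | k
      · omega
      · exact this.2 ⟨k y hy, k z hz⟩
    · have := h.zdis hy hz hne hp h1 h2
      rcases dZ with k | k
      · omega
      · exact this.2.2 ⟨k y hy, k z hz⟩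

theorem ef0 (h : C23 I a m N) (dY : N < 15 ∨ ∀ y ∈ YY I m, 9 ∣ m y)
    (dZ : N < 10 ∨ ∀ z ∈ ZZ I m, 4 ∣ m z) :
    (YY I m).card * (ZZ I m).card ≤ (bp N).card + 1 := by
  have := h.ef dY dZ _ (le_refl _) (fun y hy p hp _ => hp)
  rwa [Finset.card_insert_of_notMem bp5] at this

/-- e ≤ ρ -/
theorem ecard (h : C23 I a m N) (hN : 15 ≤ N) : (YY I m).card ≤ (bp N).card + 1 := by
  classical
  have h19 := h.N19
  have e := Finset.card_filter_add_card_filter_not (s := YY I m) (fun i => ∃ p ∈ bp N, p ∣ m i)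
  have e1 : ((YY I m).filter fun i => ∃ p ∈ bp N, p ∣ m i).card ≤ (bp N).card := by
    refine strip _ m _ (fun i hi => (Finset.mem_filter.1 hi).2) ?_
    intro i hi j hj hij p hp hpi hpj
    exact h.ydis (Finset.mem_filter.1 hi).1 (Finset.mem_filter.1 hj).1 hij hp hpi hpj
  have e2 : ((YY I m).filter fun i => ¬ ∃ p ∈ bp N, p ∣ m i).card ≤ 1 := by
    refine h.one _ ((Finset.filter_subset _ _).trans YI) 45 (by omega) ?_
    intro i hi
    obtain ⟨hi, hi2⟩ := Finset.mem_filter.1 hi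
    push Not at hi2
    have hi := h.hY hi
    have h7 := h.nobig' hi.1 hi2
    obtain ⟨q, hq, hq3, hqd, _, _⟩ := h.pp hi.1 3 (by norm_num) (by omega)
    refine d720 _ (by simp [h7]) hi.2.1 hi.2.2 ?_ ?_ (h.n15 hN i hi.1)
    · intro h5
      rw [h5, Nat.prime_dvd_prime_iff_eq hq (by norm_num)] at hqd
      exact hq3 hqd
    · intro h5
      rw [h5, show 9 = 3 ^ 2 by norm_num] at hqd
      exact hq3 ((Nat.prime_dvd_prime_iff_eq hq (by norm_num)).1 (hq.dvd_of_dvd_pow hqd))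
  omega

theorem d5040 : ∀ x ∈ Nat.divisors 5040, 2 ∣ x → ¬ 3 ∣ x → 7 ∣ x → ¬ 5 ∣ x → x ≠ 14 → 28 ∣ x := by
  decide +kernel

theorem d720c : ∀ x ∈ Nat.divisors 720, ¬ 3 ∣ x → ¬ 5 ∣ x → x ∣ 2 ^ 4 := by
  decide +kernel

/-- bound for elements of ZZ avoiding the primes in S other than 7 -/
theorem fcard (h : C23 I a m N) (hN : 10 ≤ N) (J : Finset ι) (hJ : J ⊆ ZZ I m) (S : Finset ℕ)
    (hS : S ⊆ bp N) (hJS : ∀ i ∈ J, ∀ p ∈ S, p ≠ 7 → ¬ p ∣ m i) :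
    J.card ≤ (bp N \ S).card + 3 ∧ (S = ∅ → J.card ≤ (bp N).card + 2) := by
  classical
  have h19 := h.N19
  have hJI := hJ.trans ZI
  set Q := (bp N).erase 7 \ S with hQ
  have cQ : Q.card ≤ (bp N \ S).card :=
    Finset.card_le_card (Finset.sdiff_subset_sdiff (Finset.erase_subset _ _) (le_refl _))
  have h7 : 7 ∈ bp N := mem_bp (by norm_num) (by omega)
  have cQ2 : S = ∅ → Q.card + 1 ≤ (bp N).card := by
    rintro rfl
    simp only [hQ, Finset.sdiff_empty]
    rw [Finset.card_erase_add_one h7]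
  have e := Finset.card_filter_add_card_filter_not (s := J) (fun i => ∃ p ∈ Q, p ∣ m i)
  have e1 : (J.filter fun i => ∃ p ∈ Q, p ∣ m i).card ≤ Q.card := by
    refine strip _ m _ (fun i hi => (Finset.mem_filter.1 hi).2) ?_
    intro i hi j hj hij p hp hpi hpj
    have hp2 := Finset.mem_erase.1 (Finset.mem_sdiff.1 hp).1
    exact hp2.1 (h.zdis (hJ (Finset.mem_filter.1 hi).1) (hJ (Finset.mem_filter.1 hj).1) hij
      hp2.2 hpi hpj).1
  set K := J.filter fun i => ¬ ∃ p ∈ Q, p ∣ m i with hK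
  have hKJ : K ⊆ J := Finset.filter_subset _ _
  have hKp : ∀ i ∈ K, ∀ p ∈ bp N, p ≠ 7 → ¬ p ∣ m i := by
    intro i hi p hp hp7 hd
    obtain ⟨hi, hi2⟩ := Finset.mem_filter.1 hi
    by_cases hpS : p ∈ S
    · exact hJS i hi p hpS hp7 hd
    · exact hi2 ⟨p, Finset.mem_sdiff.2 ⟨Finset.mem_erase.2 ⟨hp7, hp⟩, hpS⟩, hd⟩
  have f1 := Finset.card_filter_add_card_filter_not (s := K) (fun i => 7 ∣ m i)
  have f2 := Finset.card_filter_add_card_filter_not (s := K.filter fun i => 7 ∣ m i)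
    (fun i => 5 ∣ m i)
  have g1 : (K.filter fun i => ¬ 7 ∣ m i).card ≤ 1 := by
    refine h.one _ ((Finset.filter_subset _ _).trans (hKJ.trans hJI)) 20 (by omega) ?_
    intro i hi
    obtain ⟨hi, hi7⟩ := Finset.mem_filter.1 hi
    have hz := h.hZ (hJ (hKJ hi))
    have h720 := h.nobig' hz.1 (by
      intro p hp hd
      by_cases p7 : p = 7
      · subst p7; exact hi7 hd
      · exact hKp i hi p hp p7 hd)
    obtain ⟨q, hq, hq2, hqd, _, hqq⟩ := h.pp hz.1 2 (by norm_num) (by omega)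
    refine d720b _ (by simp [h720]) ?_ hz.2.2 (by omega) (h.n10 hN i hz.1)
    by_contra h5
    have := d720c _ (by simp [h720]) hz.2.2 h5
    exact hq2 ((Nat.prime_dvd_prime_iff_eq hq (by norm_num)).1
      (hq.dvd_of_dvd_pow (hqd.trans this)))
  have g2 : ((K.filter fun i => 7 ∣ m i).filter fun i => 5 ∣ m i).card ≤ 1 := by
    refine h.one _ ((Finset.filter_subset _ _).trans
      ((Finset.filter_subset _ _).trans (hKJ.trans hJI))) 70 (by omega) ?_
    intro i hi
    simp only [Finset.mem_filter] at hi
    have hz := h.hZ (hJ (hKJ hi.1.1))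
    omega
  have g3 : ((K.filter fun i => 7 ∣ m i).filter fun i => ¬ 5 ∣ m i).card ≤ 1 := by
    rcases lt_or_ge N 14 with hN14 | hN14
    · refine h.one _ ((Finset.filter_subset _ _).trans
        ((Finset.filter_subset _ _).trans (hKJ.trans hJI))) 14 (by omega) ?_
      intro i hi
      simp only [Finset.mem_filter] at hi
      have hz := h.hZ (hJ (hKJ hi.1.1))
      omega
    · refine h.one _ ((Finset.filter_subset _ _).trans
        ((Finset.filter_subset _ _).trans (hKJ.trans hJI))) 28 (by omega) ?_
      intro i hi
      simp only [Finset.mem_filter] at hi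
      have hz := h.hZ (hJ (hKJ hi.1.1))
      refine d5040 _ ?_ hz.2.1 hz.2.2 hi.1.2 hi.2 (h.n14 hN14 i hz.1)
      have hc : Nat.Coprime (m i) (11 * 13 * 17 * 19) := by
        have aux : ∀ p, p.Prime → (p = 11 ∨ p = 13 ∨ p = 17 ∨ p = 19) →
            Nat.Coprime (m i) p := by
          intro p hp hpp
          rw [Nat.coprime_comm, Nat.Prime.coprime_iff_not_dvd hp]
          intro hd
          exact hKp i hi.1.1 p (mem_bp (by tauto) (h.ple hz.1 hp hd)) (by omega) hd
        exact Nat.Coprime.mul_right (Nat.Coprime.mul_right (Nat.Coprime.mul_right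
          (aux 11 (by norm_num) (by norm_num)) (aux 13 (by norm_num) (by norm_num)))
          (aux 17 (by norm_num) (by norm_num))) (aux 19 (by norm_num) (by norm_num))
      have h2 : m i ∣ 5040 * (11 * 13 * 17 * 19) := by
        have := h.dvdL hz.1
        norm_num
        exact this
      have := hc.dvd_of_dvd_mul_right h2
      simp [this]
  exact ⟨by omega, fun hh => by have := cQ2 hh; omega⟩

end C23
end DC

namespace DC
namespace C23
open Ctx
variable {ι : Type} {I : Finset ι} {a : ι → ℤ} {m : ι → ℕ} {N : ℕ}

theorem cB (h : C23 I a m N) (hN : 15 ≤ N) (h4 : ∀ z ∈ ZZ I m, 4 ∣ m z) :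
    (YY I m).card + (ZZ I m).card ≤ (bp N).card + 2 := by
  classical
  have h19 := h.N19
  have hY1 := h.neY.card_pos
  have e := Finset.card_filter_add_card_filter_not (s := ZZ I m) (fun i => 5 ∣ m i)
  have e1 : ((ZZ I m).filter fun i => 5 ∣ m i).card ≤ 1 := by
    refine h.one _ ((Finset.filter_subset _ _).trans ZI) 20 (by omega) ?_
    intro i hi
    obtain ⟨hi, hi2⟩ := Finset.mem_filter.1 hi
    have := h4 i hi
    omega
  have e2 : (YY I m).card * ((ZZ I m).filter fun i => ¬ 5 ∣ m i).card ≤ (bp N).card := by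
    refine pair _ _ m _ ?_ ?_ ?_
    · intro y hy z hz
      obtain ⟨hz, hz2⟩ := Finset.mem_filter.1 hz
      obtain ⟨p, hp, k1, k2⟩ := h.cyz hy hz
      refine ⟨p, ?_, k1, k2⟩
      rcases hp with rfl | hp
      · exact absurd k2 hz2
      · exact hp
    · intro y hy z hz hne p hp h1 h2
      exact h.ydis hy hz hne hp h1 h2
    · intro y hy z hz hne p hp h1 h2
      have hy := (Finset.mem_filter.1 hy).1
      have hz := (Finset.mem_filter.1 hz).1
      exact (h.zdis hy hz hne hp h1 h2).2.2 ⟨h4 y hy, h4 z hz⟩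
  have e3 := h.ecard hN
  rcases Nat.eq_zero_or_pos ((ZZ I m).filter fun i => ¬ 5 ∣ m i).card with h0 | h0
  · omega
  · have := mul_le_add _ _ _ hY1 h0 e2
    omega

theorem cC (h : C23 I a m N) (hN : 10 ≤ N) (dY : N < 15 ∨ ∀ y ∈ YY I m, 9 ∣ m y) :
    (YY I m).card + (ZZ I m).card ≤ (bp N).card + 4 := by
  classical
  have h19 := h.N19
  have hZ1 := h.neZ.card_pos
  have h7 : 7 ∈ bp N := mem_bp (by norm_num) (by omega)
  have e := Finset.card_filter_add_card_filter_not (s := YY I m) (fun i => 5 ∣ m i)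
  have e' := Finset.card_filter_add_card_filter_not (s := (YY I m).filter fun i => ¬ 5 ∣ m i)
    (fun i => 7 ∣ m i)
  have e1 : ((YY I m).filter fun i => 5 ∣ m i).card ≤ 1 := by
    rw [Finset.card_le_one]
    intro i hi j hj
    by_contra hne
    obtain ⟨hi, hi2⟩ := Finset.mem_filter.1 hi
    obtain ⟨hj, hj2⟩ := Finset.mem_filter.1 hj
    have := h.y5 hi hj hne hi2 hj2
    rcases dY with k | k
    · omega
    · exact this.2 ⟨k i hi, k j hj⟩
  have e1' : (((YY I m).filter fun i => ¬ 5 ∣ m i).filter fun i => 7 ∣ m i).card ≤ 1 := by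
    rw [Finset.card_le_one]
    intro i hi j hj
    by_contra hne
    simp only [Finset.mem_filter] at hi hj
    exact h.ydis hi.1.1 hj.1.1 hne h7 hi.2 hj.2
  set Y := ((YY I m).filter fun i => ¬ 5 ∣ m i).filter fun i => ¬ 7 ∣ m i with hY
  have e2 : Y.card * (ZZ I m).card ≤ ((bp N).erase 7).card := by
    refine pair _ _ m _ ?_ ?_ ?_
    · intro y hy z hz
      simp only [hY, Finset.mem_filter] at hy
      obtain ⟨p, hp, k1, k2⟩ := h.cyz hy.1.1 hz
      refine ⟨p, ?_, k1, k2⟩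
      rcases hp with rfl | hp
      · exact absurd k1 hy.1.2
      · exact Finset.mem_erase.2 ⟨by rintro rfl; exact hy.2 k1, hp⟩
    · intro y hy z hz hne p hp h1 h2
      simp only [hY, Finset.mem_filter] at hy hz
      exact h.ydis hy.1.1 hz.1.1 hne (Finset.mem_erase.1 hp).2 h1 h2
    · intro y hy z hz hne p hp h1 h2
      have hp := Finset.mem_erase.1 hp
      exact hp.1 (h.zdis hy hz hne hp.2 h1 h2).1
  have e3 := (h.fcard hN _ (le_refl _) ∅ (by simp) (by simp)).2 rfl
  have e4 := Finset.card_erase_add_one h7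
  rcases Nat.eq_zero_or_pos Y.card with h0 | h0
  · omega
  · have := mul_le_add _ _ _ h0 hZ1 e2
    omega

theorem cD (h : C23 I a m N) (hN : 15 ≤ N) :
    (YY I m).card + (ZZ I m).card ≤ (bp N).card + 4 ∨
    ((YY I m).card ≤ (bp N).card + 1 ∧ (ZZ I m).card ≤ (bp N).card + 1 ∧
      (YY I m).card + (ZZ I m).card ≤ 2 * (bp N).card + 1) ∨
    (YY I m).card + (ZZ I m).card ≤ (bp N).card + 2 := by
  classical
  have h19 := h.N19
  have he := h.ecard hN
  by_cases hz : ∃ z ∈ ZZ I m, ¬ 5 ∣ m z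
  · left
    obtain ⟨z, hz, hz5⟩ := hz
    set S := (bp N).filter fun p => p ∣ m z with hS
    have hSb : S ⊆ bp N := Finset.filter_subset _ _
    have e1 : (YY I m).card ≤ S.card := by
      refine strip _ m _ ?_ ?_
      · intro y hy
        obtain ⟨p, hp, k1, k2⟩ := h.cyz hy hz
        refine ⟨p, ?_, k1⟩
        rcases hp with rfl | hp
        · exact absurd k2 hz5
        · exact Finset.mem_filter.2 ⟨hp, k2⟩
      · intro y hy z hz hne p hp h1 h2
        exact h.ydis hy hz hne (hSb hp) h1 h2
    have e2 := (h.fcard (by omega) ((ZZ I m).erase z) (Finset.erase_subset _ _) S hSb (by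
      intro i hi p hp hp7 hd
      have hi := Finset.mem_erase.1 hi
      have hp := Finset.mem_filter.1 hp
      exact hp7 (h.zdis hi.2 hz hi.1 hp.1 hd hp.2).1)).1
    have e3 := Finset.card_erase_add_one hz
    have e4 := Finset.card_sdiff_add_card_eq_card hSb
    omega
  · push Not at hz
    right
    have hf := h.w5 (h.n10 (by omega)) (ZZ I m) ZI (fun i hi => ⟨hz i hi, (h.hZ hi).2.2⟩)
    by_cases hy : ∃ y ∈ YY I m, ¬ 5 ∣ m y
    · left
      obtain ⟨y, hy, hy5⟩ := hy
      have : (ZZ I m).card ≤ (bp N).card := by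
        refine strip _ m _ ?_ ?_
        · intro z hz
          obtain ⟨p, hp, k1, k2⟩ := h.cyz hy hz
          refine ⟨p, ?_, k2⟩
          rcases hp with rfl | hp
          · exact absurd k1 hy5
          · exact hp
        · intro i hi j hj hne p hp h1 h2
          have hp7 := (h.zdis hi hj hne hp h1 h2).1
          subst hp7
          have := hz i hi
          have := hz j hj
          have := h.dle (ZI hi) (ZI hj) hne 35 (by omega) (by omega)
          omega
      omega
    · push Not at hy
      right
      have dis : Disjoint (YY I m) (ZZ I m) := by
        rw [Finset.disjoint_left]
        intro i hi hj
        exact (h.hZ hj).2.2 (h.hY hi).2.2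
      rw [← Finset.card_union_of_disjoint dis]
      set U := YY I m ∪ ZZ I m with hU
      have hUI : U ⊆ I := Finset.union_subset YI ZI
      have hU5 : ∀ i ∈ U, 5 ∣ m i := by
        intro i hi
        rcases Finset.mem_union.1 hi with hi | hi
        · exact hy i hi
        · exact hz i hi
      have e := Finset.card_filter_add_card_filter_not (s := U) (fun i => ∃ p ∈ bp N, p ∣ m i)
      have e1 : (U.filter fun i => ∃ p ∈ bp N, p ∣ m i).card ≤ (bp N).card := by
        refine strip _ m _ (fun i hi => (Finset.mem_filter.1 hi).2) ?_
        intro i hi j hj hij p hp hpi hpj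
        have hi := (Finset.mem_filter.1 hi).1
        have hj := (Finset.mem_filter.1 hj).1
        have h7 := bp_mem hp
        have := h.dle2 (hUI hi) (hUI hj) hij 5 p (by
          rcases h7 with ⟨rfl | rfl | rfl | rfl | rfl, _⟩ <;> norm_num)
          (hU5 i hi) (hU5 j hj) hpi hpj
        omega
      set V := U.filter fun i => ¬ ∃ p ∈ bp N, p ∣ m i with hV
      have hVU : V ⊆ U := Finset.filter_subset _ _
      have hV7 : ∀ i ∈ V, m i ∣ 720 := by
        intro i hi
        have := (Finset.mem_filter.1 hi).2
        push Not at this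
        exact h.nobig' (hUI (hVU hi)) this
      have e2 := Finset.card_filter_add_card_filter_not (s := V) (fun i => 3 ∣ m i)
      have e3 : (V.filter fun i => 3 ∣ m i).card ≤ 1 := by
        refine h.one _ ((Finset.filter_subset _ _).trans (hVU.trans hUI)) 45 (by omega) ?_
        intro i hi
        obtain ⟨hi, hi3⟩ := Finset.mem_filter.1 hi
        have h5 := hU5 i (hVU hi)
        have hi2 : ¬ 2 ∣ m i := by
          rcases Finset.mem_union.1 (hVU hi) with k | k
          · exact (h.hY k).2.1
          · exact absurd hi3 (h.hZ k).2.2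
        exact d720 _ (by simp [hV7 i hi]) hi2 hi3 (by omega) (by omega)
          (h.n15 hN i (hUI (hVU hi)))
      have e4 : (V.filter fun i => ¬ 3 ∣ m i).card ≤ 1 := by
        refine h.one _ ((Finset.filter_subset _ _).trans (hVU.trans hUI)) 20 (by omega) ?_
        intro i hi
        obtain ⟨hi, hi3⟩ := Finset.mem_filter.1 hi
        have h5 := hU5 i (hVU hi)
        have hi2 : 2 ∣ m i := by
          rcases Finset.mem_union.1 (hVU hi) with k | k
          · exact absurd (h.hY k).2.2 hi3
          · exact (h.hZ k).2.1
        exact d720b _ (by simp [hV7 i hi]) h5 hi3 (by omega) (h.n10 (by omega) i (hUI (hVU hi)))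
      omega

/-- the case where some y is not divisible by 9, or some z is not divisible by 4 -/
theorem cBCD (h : C23 I a m N)
    (hno : ¬ ((∀ y ∈ YY I m, 9 ∣ m y) ∧ ∀ z ∈ ZZ I m, 4 ∣ m z)) : False := by
  have h19 := h.N19
  have hN6 := h.N6
  have hb := h.big
  have ht := h.total
  have hE := h.Ecard
  have hY1 := h.neY.card_pos
  have hZ1 := h.neZ.card_pos
  have hbp : (bp N).card = if N < 7 then 0 else if N < 11 then 1 else if N < 13 then 2 else
      if N < 17 then 3 else if N < 19 then 4 else 5 := by
    clear * - h19 hN6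
    interval_cases N <;> decide
  have low : N < 10 → (YY I m).card + (ZZ I m).card ≤ (bp N).card + 2 := by
    intro h10
    have := mul_le_add _ _ _ hY1 hZ1 (h.ef0 (Or.inl (by omega)) (Or.inl h10))
    omega
  by_cases hy : ∀ y ∈ YY I m, 9 ∣ m y
  · have hz : ∃ z ∈ ZZ I m, ¬ 4 ∣ m z := by
      by_contra hc
      push Not at hc
      exact hno ⟨hy, hc⟩
    obtain ⟨z, hz, hz4⟩ := hz
    obtain ⟨y, hy0⟩ := h.neY
    obtain ⟨c1, c2, c3, c4, c5, c6, c7, c8⟩ := h.caps y z hy0 hz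
    have c8 := c8 hz4
    have hs := Tsum (I := I) (a := a) (m := m) (N := N) y z
    rcases lt_or_ge N 10 with h10 | h10
    · have := low h10
      split_ifs at hbp <;> omega
    · have := h.cC h10 (Or.inr hy)
      split_ifs at hbp <;> omega
  · push Not at hy
    obtain ⟨y, hy, hy9⟩ := hy
    by_cases hz : ∀ z ∈ ZZ I m, 4 ∣ m z
    · obtain ⟨z, hz0⟩ := h.neZ
      obtain ⟨c1, c2, c3, c4, c5, c6, c7, c8⟩ := h.caps y z hy hz0
      have c7 := c7 hy9
      have hs := Tsum (I := I) (a := a) (m := m) (N := N) y z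
      rcases lt_or_ge N 15 with h10 | h10
      · have := mul_le_add _ _ _ hY1 hZ1 (h.ef0 (Or.inl (by omega)) (Or.inr hz))
        split_ifs at hbp <;> omega
      · have := h.cB h10 hz
        split_ifs at hbp <;> omega
    · push Not at hz
      obtain ⟨z, hz, hz4⟩ := hz
      obtain ⟨c1, c2, c3, c4, c5, c6, c7, c8⟩ := h.caps y z hy hz
      have c7 := c7 hy9
      have c8 := c8 hz4
      have hs := Tsum (I := I) (a := a) (m := m) (N := N) y z
      rcases lt_or_ge N 10 with h10 | h10
      · have := low h10
        split_ifs at hbp <;> omega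
      rcases lt_or_ge N 15 with h15 | h15
      · have := h.cC h10 (Or.inl h15)
        split_ifs at hbp <;> omega
      · have := h.cD h15
        split_ifs at hbp <;> omega

end C23
end DC

namespace DC
namespace C23
open Ctx
variable {ι : Type} {I : Finset ι} {a : ι → ℤ} {m : ι → ℕ} {N : ℕ}

theorem efE (h : C23 I a m N) (h15 : N < 15) (h4 : ∀ z ∈ ZZ I m, 4 ∣ m z)
    (hE : (EE I m N).Nonempty) : (YY I m).card * (ZZ I m).card ≤ (bp N).card := by
  classical
  obtain ⟨x, hx⟩ := hE
  simp only [EE, Finset.mem_filter] at hx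
  obtain ⟨xI, x2, x3, hx⟩ := hx
  have key : ∃ p ∈ insert 5 (bp N), ∀ y ∈ YY I m, ¬ p ∣ m y := by
    rcases hx with ⟨hN, hx⟩ | ⟨hN, hx⟩
    · refine ⟨5, by simp, ?_⟩
      intro y hy hd
      have hy := h.hY hy
      have := h.dle xI hy.1 (by rintro rfl; tauto) 15 (by omega) (by omega)
      omega
    · refine ⟨7, Finset.mem_insert_of_mem (mem_bp (by norm_num) (by omega)), ?_⟩
      intro y hy hd
      have hy := h.hY hy
      have := h.dle xI hy.1 (by rintro rfl; tauto) 21 (by omega) (by omega)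
      omega
  obtain ⟨p, hp, hpy⟩ := key
  have e := h.ef (Or.inl h15) (Or.inr h4) ((insert 5 (bp N)).erase p) (Finset.erase_subset _ _) (by
    intro y hy q hq hd
    refine Finset.mem_erase.2 ⟨?_, hq⟩
    rintro rfl
    exact hpy y hy hd)
  rw [Finset.card_erase_of_mem hp, Finset.card_insert_of_notMem bp5] at e
  simpa using e

theorem tZ (h : C23 I a m N) (hN : 18 ≤ N) (h4 : ∀ z ∈ ZZ I m, 4 ∣ m z)
    (hf : 4 ≤ (ZZ I m).card) :
    (TT I m N).card ≤ 9 ∨ ((ZZ I m).card = 4 ∧ (TT I m N).card ≤ 11) := by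
  classical
  have h19 := h.N19
  obtain ⟨y, hy⟩ := h.neY
  by_cases c1 : ∃ z ∈ ZZ I m, ∃ z' ∈ ZZ I m, a z % 2 ≠ a z' % 2
  · left
    obtain ⟨z, hz, z', hz', hne⟩ := c1
    obtain ⟨-, -, -, c3, -, c4, -, -⟩ := h.caps y z hy hz
    obtain ⟨-, -, -, d3, -, d4, -, -⟩ := h.caps y z' hy hz'
    have s1 : T1 I a m N y z = T3 I a m N y z' := by
      apply Finset.filter_congr
      intro x _
      have : ¬ a x % 2 = a z % 2 ↔ a x % 2 = a z' % 2 := by omega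
      rw [this]
    have s2 : T2 I a m N y z = T4 I a m N y z' := by
      apply Finset.filter_congr
      intro x _
      have : ¬ a x % 2 = a z % 2 ↔ a x % 2 = a z' % 2 := by omega
      rw [this]
    have hs := Tsum (I := I) (a := a) (m := m) (N := N) y z
    rw [s1, s2] at hs
    omega
  push Not at c1
  by_cases c2 : ∃ z ∈ ZZ I m, ∃ z' ∈ ZZ I m, a z % 4 ≠ a z' % 4
  · left
    obtain ⟨z, hz, z', hz', hne⟩ := c2
    obtain ⟨c3, c4, -, -, -, -, -, -⟩ := h.caps y z hy hz
    have hs := Tsum (I := I) (a := a) (m := m) (N := N) y z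
    have hzz := c1 z hz z' hz'
    have hd : ∀ x ∈ TT I m N, a x % 2 = a z % 2 → 24 ∣ m x := by
      intro x hx hxz
      have k1 := (h.d12 hx hz hxz).2.2
      have k2 := (h.d12 hx hz' (by omega)).2.2
      omega
    have s3 : T3 I a m N y z ⊆ TT I m N := Finset.filter_subset _ _
    have s4 : T4 I a m N y z ⊆ TT I m N := Finset.filter_subset _ _
    have := h.card_add_one (T3 I a m N y z) (T4 I a m N y z) s3 s4 (by
      rw [Finset.disjoint_left]
      intro i hi hj
      exact (Finset.mem_filter.1 hi).2.2 (Finset.mem_filter.1 hj).2.2) 24 (by omega)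
      (fun i hi => hd i (s3 hi) (Finset.mem_filter.1 hi).2.1)
      (fun i hi => hd i (s4 hi) (Finset.mem_filter.1 hi).2.1)
    omega
  push Not at c2
  right
  obtain ⟨z, hz⟩ := h.neZ
  obtain ⟨c3, c4, -, -, -, c6, -, -⟩ := h.caps y z hy hz
  have hs := Tsum (I := I) (a := a) (m := m) (N := N) y z
  have r0 := h.row0 (ZZ I m) ZI 4 (by norm_num) h4 (fun i hi j hj => c2 i hi j hj)
  have hf4 : (ZZ I m).card = 4 := by omega
  refine ⟨hf4, ?_⟩
  have s3 : T3 I a m N y z ⊆ TT I m N := Finset.filter_subset _ _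
  have hn4 : ∀ x ∈ T3 I a m N y z, a x % 4 ≠ a z % 4 := by
    intro x hx hx4
    have hxz := h.d12 (s3 hx) hz (Finset.mem_filter.1 hx).2.1
    have hxn : x ∉ ZZ I m := fun hh => (h.hZ hh).2.2 (by have := (hT (s3 hx)).2.1; omega)
    have r1 := h.row0 (insert x (ZZ I m)) (Finset.insert_subset (TI (s3 hx)) ZI) 4 (by norm_num)
      (by
        intro i hi
        rcases Finset.mem_insert.1 hi with rfl | hi
        · omega
        · exact h4 i hi)
      (by
        have key : ∀ i ∈ insert x (ZZ I m), a i % 4 = a z % 4 := by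
          intro i hi
          rcases Finset.mem_insert.1 hi with rfl | hi
          · exact hx4
          · exact c2 i hi z hz
        intro i hi j hj
        have := key i hi
        have := key j hj
        norm_num
        omega)
    rw [Finset.card_insert_of_notMem hxn] at r1
    omega
  have l := h.L12 (T3 I a m N y z) s3 _ (sing3 (a y))
    (fun i hi => (h.d12 (s3 hi) hz (Finset.mem_filter.1 hi).2.1).1)
    (by
      intro i hi j hj
      have := hn4 i hi
      have := hn4 j hj
      have := (Finset.mem_filter.1 hi).2.1
      have := (Finset.mem_filter.1 hj).2.1
      omega)
    (fun i hi => by simpa using (Finset.mem_filter.1 hi).2.2)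
  rw [Finset.card_singleton] at l
  omega

theorem tY (h : C23 I a m N) (hN : 18 ≤ N) (h9 : ∀ y ∈ YY I m, 9 ∣ m y)
    (he : 4 ≤ (YY I m).card) : (TT I m N).card ≤ 10 := by
  classical
  have h19 := h.N19
  have hne : ∃ y ∈ YY I m, ∃ y' ∈ YY I m, a y % 3 ≠ a y' % 3 := by
    by_contra hc
    push Not at hc
    have := card3 (YY I m) a hc (by
      intro i hi j hj hij hh
      have hi' := h.hY hi
      have hj' := h.hY hj
      obtain ⟨q, hq, e1, e2, e3, e4⟩ := h.sepn hi'.1 hj'.1 hij 9 (h9 i hi) (h9 j hj)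
      rcases hq with rfl | rfl | rfl | rfl | rfl | rfl | rfl | rfl | rfl | rfl | rfl | rfl <;>
        norm_num [Nat.lcm] at e1 e2 e3 e4 <;> omega)
    omega
  obtain ⟨y, hy, y', hy', hne⟩ := hne
  obtain ⟨z, hz⟩ := h.neZ
  have hs := Tsum (I := I) (a := a) (m := m) (N := N) y z
  obtain ⟨-, c2, -, -, -, -, -, -⟩ := h.caps y z hy hz
  obtain ⟨-, d2, -, -, -, -, -, -⟩ := h.caps y' z hy' hz
  have e1 := Finset.card_filter_add_card_filter_not (s := T1 I a m N y z)
    (fun i => a i % 3 = a y' % 3)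
  have e3 := Finset.card_filter_add_card_filter_not (s := T3 I a m N y z)
    (fun i => a i % 3 = a y' % 3)
  have s1 : T1 I a m N y z ⊆ TT I m N := Finset.filter_subset _ _
  have s3 : T3 I a m N y z ⊆ TT I m N := Finset.filter_subset _ _
  have s4 : T4 I a m N y z ⊆ TT I m N := Finset.filter_subset _ _
  have f1 : ((T1 I a m N y z).filter fun i => a i % 3 = a y' % 3).card ≤
      (T2 I a m N y' z).card := by
    apply Finset.card_le_card
    intro i hi
    simp only [T1, T2, Finset.mem_filter] at hi ⊢
    tauto
  have hW : ({a y % 3, a y' % 3} : Finset ℤ) ⊆ Finset.Ico 0 ((3 : ℕ) : ℤ) := by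
    intro r hr
    simp only [Finset.mem_insert, Finset.mem_singleton] at hr
    simp only [Finset.mem_Ico]
    norm_num
    omega
  have hWc : ({a y % 3, a y' % 3} : Finset ℤ).card = 2 := Finset.card_pair hne
  have l6 := h.L6 ((T1 I a m N y z).filter fun i => ¬ a i % 3 = a y' % 3)
    ((Finset.filter_subset _ _).trans s1) _ hW
    (by
      intro i hi j hj
      simp only [T1, Finset.mem_filter] at hi hj
      omega)
    (by
      intro i hi
      simp only [T1, Finset.mem_filter] at hi
      simp only [Finset.mem_insert, Finset.mem_singleton]
      tauto)
  have l3 := h.L3 ((T3 I a m N y z).filter fun i => ¬ a i % 3 = a y' % 3)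
    ((Finset.filter_subset _ _).trans s3) _ hW z hz
    (by
      intro i hi
      simp only [T3, Finset.mem_filter] at hi
      omega)
    (by
      intro i hi
      simp only [T3, Finset.mem_filter] at hi
      simp only [Finset.mem_insert, Finset.mem_singleton]
      tauto)
  rw [hWc] at l6 l3
  have l4 := h.card_add_one ((T3 I a m N y z).filter fun i => a i % 3 = a y' % 3)
    (T4 I a m N y z) ((Finset.filter_subset _ _).trans s3) s4 (by
      rw [Finset.disjoint_left]
      intro i hi hj
      exact (Finset.mem_filter.1 (Finset.mem_filter.1 hi).1).2.2 (Finset.mem_filter.1 hj).2.2) 36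
      (by omega)
      (by
        intro i hi
        obtain ⟨hi, hi2⟩ := Finset.mem_filter.1 hi
        have := (h.d12 (s3 hi) hz (Finset.mem_filter.1 hi).2.1).1
        have := (h.d18 (s3 hi) hy' hi2).1
        omega)
      (by
        intro i hi
        have := (h.d12 (s4 hi) hz (Finset.mem_filter.1 hi).2.1).1
        have := (h.d18 (s4 hi) hy (Finset.mem_filter.1 hi).2.2).1
        omega)
  omega

theorem false (h : C23 I a m N) : False := by
  by_cases hno : (∀ y ∈ YY I m, 9 ∣ m y) ∧ ∀ z ∈ ZZ I m, 4 ∣ m z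
  swap
  · exact h.cBCD hno
  obtain ⟨h9, h4⟩ := hno
  have h19 := h.N19
  have hN6 := h.N6
  have hb := h.big
  have ht := h.total
  have hE := h.Ecard
  have hY1 := h.neY.card_pos
  have hZ1 := h.neZ.card_pos
  have hbp : (bp N).card = if N < 7 then 0 else if N < 11 then 1 else if N < 13 then 2 else
      if N < 17 then 3 else if N < 19 then 4 else 5 := by
    clear * - h19 hN6
    interval_cases N <;> decide
  have hef := h.ef0 (Or.inr h9) (Or.inr h4)
  have hsum := mul_le_add _ _ _ hY1 hZ1 hef
  obtain ⟨y, hy⟩ := h.neY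
  obtain ⟨z, hz⟩ := h.neZ
  obtain ⟨c1, c2, c3, c4, c5, c6, -, -⟩ := h.caps y z hy hz
  have hs := Tsum (I := I) (a := a) (m := m) (N := N) y z
  rcases lt_or_ge N 18 with h18 | h18
  · rcases Nat.eq_zero_or_pos (EE I m N).card with h0 | h0
    · split_ifs at hbp <;> omega
    rcases lt_or_ge N 15 with h15 | h15
    · have := mul_le_add _ _ _ hY1 hZ1 (h.efE h15 h4 (Finset.card_pos.1 h0))
      split_ifs at hbp <;> omega
    · split_ifs at hbp <;> omega
  · have hbp2 : (bp N).card + 14 = N := by split_ifs at hbp <;> omega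
    rcases lt_or_ge (ZZ I m).card 4 with hz4 | hz4
    · rcases lt_or_ge (YY I m).card 4 with hy4 | hy4
      · have : (YY I m).card + (ZZ I m).card ≤ (bp N).card := by
          have hN : N = 18 ∨ N = 19 := by omega
          generalize (YY I m).card = e at *
          generalize (ZZ I m).card = f at *
          clear * - hbp2 hN hef hY1 hZ1 hz4 hy4
          interval_cases e <;> interval_cases f <;> omega
        omega
      · have := h.tY h18 h9 hy4
        omega
    · have he1 : (YY I m).card = 1 := by
        by_contra hne
        have : 2 * 4 ≤ (YY I m).card * (ZZ I m).card := Nat.mul_le_mul (by omega) hz4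
        omega
      have := h.tZ h18 h4 hz4
      omega

end C23
end DC

namespace DC

/-! ### Part 7: assembly -/

namespace Ctx
variable {ι : Type} {I : Finset ι} {a : ι → ℤ} {m : ι → ℕ} {N : ℕ}

theorem npp (h : Ctx I a m N) {i : ι} (hi : i ∈ I) (p k : ℕ) (hp : p.Prime) (hpN : p ≤ N) :
    m i ≠ p ^ k := by
  intro hm
  obtain ⟨q, hq, hqp, hqd, _, _⟩ := h.pp hi p hp hpN
  rw [hm] at hqd
  exact hqp ((Nat.prime_dvd_prime_iff_eq hq hp).1 (hq.dvd_of_dvd_pow hqd))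

theorem small (h : Ctx I a m N) {i : ι} (hi : i ∈ I) (hN : m i ≤ N) :
    m i = 6 ∨ m i = 10 ∨ m i = 12 ∨ m i = 14 ∨ m i = 15 ∨ m i = 18 := by
  have h19 := h.N19
  have h2 := h.two
  have hpos := h.pos i hi
  have key := fun p k => h.npp hi p k
  generalize m i = v at *
  have hv : v ≤ 19 := hN.trans h19
  interval_cases v
  · exact absurd rfl (key 2 0 (by norm_num) (by omega))
  · exact absurd rfl (key 2 1 (by norm_num) (by omega))
  · exact absurd rfl (key 3 1 (by norm_num) (by omega))
  · exact absurd rfl (key 2 2 (by norm_num) (by omega))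
  · exact absurd rfl (key 5 1 (by norm_num) (by omega))
  · norm_num
  · exact absurd rfl (key 7 1 (by norm_num) (by omega))
  · exact absurd rfl (key 2 3 (by norm_num) (by omega))
  · exact absurd rfl (key 3 2 (by norm_num) (by omega))
  · norm_num
  · exact absurd rfl (key 11 1 (by norm_num) (by omega))
  · norm_num
  · exact absurd rfl (key 13 1 (by norm_num) (by omega))
  · norm_num
  · norm_num
  · exact absurd rfl (key 2 4 (by norm_num) (by omega))
  · exact absurd rfl (key 17 1 (by norm_num) (by omega))
  · norm_num
  · exact absurd rfl (key 19 1 (by norm_num) (by omega))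

theorem false (h : Ctx I a m N) : False := by
  have hb := h.big
  have h15 : 15 ≤ N → ∀ i ∈ I, m i ≠ 15 := fun hN i hi hm => h.P15 hN i hi hm
  have h14 : 14 ≤ N → ∀ i ∈ I, m i ≠ 14 := fun hN i hi hm => h.P14 hN i hi hm
  have h10 : 10 ≤ N → ∀ i ∈ I, m i ≠ 10 := fun hN i hi hm => h.P10 hN h15 i hi hm
  by_cases hs : ∃ i ∈ I, m i ≤ N
  · obtain ⟨i, hi, hiN⟩ := hs
    have hv := h.small hi hiN
    have k1 := fun hN => h15 hN i hi
    have k2 := fun hN => h14 hN i hi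
    have k3 := fun hN => h10 hN i hi
    have hv' : m i = 6 ∨ m i = 12 ∨ m i = 18 := by
      omega
    have hC : C23 I a m N := by
      refine ⟨h, ?_, h10, h14, h15, by omega⟩
      intro j hj
      by_cases hij : j = i
      · subst hij; omega
      obtain ⟨p, hp, d1, d2, -, hpp⟩ := h.cp hj hi hij
      rcases hpp with rfl | rfl | rfl | rfl | rfl | rfl | rfl | rfl <;> omega
    exact hC.false
  · push Not at hs
    have := colour N h.two h.N19 I m (fun x hx => ⟨hs x hx, h.dvd x hx⟩)
      (fun x hx y hy hxy => ⟨h.gt1 hx hy hxy, h.le x hx y hy hxy⟩)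
    omega

end Ctx

theorem LN_pos (N : ℕ) (hN : N ≤ 19) : 0 < LN N :=
  Nat.pos_of_dvd_of_pos (LN_dvd N hN) (by norm_num)

theorem all_PP (ι : Type) : ∀ N ≤ 19, PP ι N := by
  intro N
  induction N using Nat.strong_induction_on with
  | _ N IH =>
  intro hN I a m hS
  have g1 : ∀ i ∈ I, ∀ j ∈ I, i ≠ j → 1 < Nat.gcd (m i) (m j) := by
    intro i hi j hj hij
    have h1 := Nat.gcd_pos_of_pos_left (m j) (hS.pos i hi)
    have h2 : Nat.gcd (m i) (m j) ≠ 1 := by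
      intro h0
      apply hS.nd i hi j hj hij
      rw [h0]; simp
    omega
  rcases lt_or_ge N 2 with h2 | h2
  · have : I.card ≤ 1 := by
      rw [Finset.card_le_one]
      intro i hi j hj
      by_contra hij
      have := g1 i hi j hj hij
      have := hS.le i hi j hj hij
      omega
    omega
  by_contra hlt
  have hbig : N < I.card := by omega
  have gg : ∀ i ∈ I, ∀ j ∈ I, i ≠ j →
      Nat.gcd (Nat.gcd (m i) (LN N)) (Nat.gcd (m j) (LN N)) = Nat.gcd (m i) (m j) := by
    intro i hi j hj hij
    have k1 := g1 i hi j hj hij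
    have k2 := dvd_LN N hN _ (hS.le i hi j hj hij) (by omega)
    apply Nat.dvd_antisymm
    · exact Nat.dvd_gcd ((Nat.gcd_dvd_left _ _).trans (Nat.gcd_dvd_left _ _))
        ((Nat.gcd_dvd_right _ _).trans (Nat.gcd_dvd_left _ _))
    · exact Nat.dvd_gcd (Nat.dvd_gcd (Nat.gcd_dvd_left _ _) k2)
        (Nat.dvd_gcd (Nat.gcd_dvd_right _ _) k2)
  have hS' : Sys I a (fun i => Nat.gcd (m i) (LN N)) N := by
    refine ⟨?_, ?_, ?_⟩
    · intro i hi
      exact Nat.gcd_pos_of_pos_left _ (hS.pos i hi)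
    · intro i hi j hj hij
      have := gg i hi j hj hij
      show Nat.gcd (Nat.gcd (m i) (LN N)) (Nat.gcd (m j) (LN N)) ≤ N
      rw [this]
      exact hS.le i hi j hj hij
    · intro i hi j hj hij
      show ¬ ((Nat.gcd (Nat.gcd (m i) (LN N)) (Nat.gcd (m j) (LN N)) : ℕ) : ℤ) ∣ _
      rw [gg i hi j hj hij]
      exact hS.nd i hi j hj hij
  refine Ctx.false (I := I) (a := a) (m := fun i => Nat.gcd (m i) (LN N)) (N := N)
    ⟨hS', h2, hN, fun B hB => IH B hB (by omega), fun i _ => Nat.gcd_dvd_right _ _, hbig, ?_⟩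
  intro p hp hpN
  by_contra hall
  push Not at hall
  have hc : I.card ≤ (N / p) * (p - (∅ : Finset ℤ).card) := by
    have hdp : 1 ≤ N / p := Nat.div_pos hpN (by omega)
    have hdl : N / p < N := Nat.div_lt_self (by omega) (by omega)
    refine cls I a p (by omega) ∅ (by simp) _ (by simp) ?_
    intro r
    have hsub : ∀ i ∈ I.filter (fun i => a i % (p : ℤ) = r), i ∈ I :=
      fun i hi => (Finset.mem_filter.1 hi).1
    have := row (IH (N / p) hdl (by omega)) (I.filter fun i => a i % (p : ℤ) = r) a
      (fun i => Nat.gcd (m i) (LN N)) (n := p) (by omega)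
      (fun i hi => hS'.pos i (hsub i hi)) (fun i hi => hall i (hsub i hi))
      (fun i hi j hj => by rw [(Finset.mem_filter.1 hi).2, (Finset.mem_filter.1 hj).2])
      (fun i hi j hj hij => lt_of_le_of_lt (hS'.le i (hsub i hi) j (hsub j hj) hij)
        (Nat.lt_mul_div_succ N (by omega)))
      (fun i hi j hj hij => hS'.nd i (hsub i hi) j (hsub j hj) hij)
    omega
  rw [Finset.card_empty, Nat.sub_zero] at hc
  have := Nat.div_mul_le_self N p
  omega

theorem disj_nd (a b : ℤ) (m n : ℕ) (h : ((Nat.gcd m n : ℕ) : ℤ) ∣ a - b) :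
    ∃ x : ℤ, Int.ModEq (m : ℤ) x a ∧ Int.ModEq (n : ℤ) x b := by
  obtain ⟨t, ht⟩ := h
  rw [Nat.gcd_eq_gcd_ab] at ht
  refine ⟨a - m * Nat.gcdA m n * t, ?_, ?_⟩
  · rw [Int.modEq_iff_dvd]
    exact ⟨Nat.gcdA m n * t, by ring⟩
  · rw [Int.modEq_iff_dvd]
    refine ⟨- (Nat.gcdB m n * t), ?_⟩
    linear_combination -ht

end DC

theorem dccc_up_to_twenty (k : ℕ) (hk2 : 2 ≤ k) (hk20 : k ≤ 20)
    (a : Fin k → ℤ) (m : Fin k → ℕ) (hm : ∀ i, 0 < m i)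
    (hdisj : ∀ i j, i ≠ j → Disjoint (congClass (a i) (m i)) (congClass (a j) (m j))) :
    ∃ i j : Fin k, i < j ∧ k ≤ Nat.gcd (m i) (m j) := by
  by_contra hcon
  push Not at hcon
  have hle : ∀ i j : Fin k, i ≠ j → Nat.gcd (m i) (m j) ≤ k - 1 := by
    intro i j hij
    rcases lt_or_gt_of_ne hij with h | h
    · have := hcon i j h
      omega
    · have := hcon j i h
      rw [Nat.gcd_comm] at this
      omega
  have hS : DC.Sys (Finset.univ : Finset (Fin k)) a m (k - 1) := by
    refine ⟨fun i _ => hm i, fun i _ j _ hij => hle i j hij, ?_⟩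
    intro i _ j _ hij hd
    obtain ⟨x, hx1, hx2⟩ := DC.disj_nd _ _ _ _ hd
    exact Set.disjoint_left.1 (hdisj i j hij) hx1 hx2
  have := DC.all_PP (Fin k) (k - 1) (by omega) _ a m hS
  rw [Finset.card_univ, Fintype.card_fin] at this
  omega
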